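/- arXiv:2512.21112 — 5 statements merged into one kernel-verified Lean document; each statement's English description precedes it below -/
import Mathlib

section
/- (Butterfly network) Let X, Y be hyperconfusions over a finite probability space (Ω, p), and let M* := (X→Y) ∩ (Y→X). Let H* := inf{ H(M) : M ∈ OIs(Ω), X∩M ⊆ Y, Y∩M ⊆ X } and H₀* := inf{ H₀(M) : M ∈ OIs(Ω), X∩M ⊆ Y, Y∩M ⊆ X }. Then H(M*) ≤ H* ≤ H(M*) + log₂(H(M*) + 3.4) + 1, and H* ≤ H₀* = H₀(M*). -/
open Finset
open scoped Classical ENNReal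

noncomputable section

variable {Ω : Type*}

/-- `X` is a confusion hypergraph (hyperconfusion) over `Ω`: a nonempty,
downward-closed family of subsets of `Ω`. -/
def IsHyp (X : Finset (Finset Ω)) : Prop :=
  X.Nonempty ∧ ∀ A ∈ X, ∀ B ⊆ A, B ∈ X

/-- `p` is a probability mass function on the finite type `Ω`. -/
def IsPMF [Fintype Ω] (p : Ω → ℝ) : Prop :=
  (∀ ω, 0 ≤ p ω) ∧ ∑ ω : Ω, p ω = 1

/-- The probability of a set `A` under the pmf `p`. -/
def pset (p : Ω → ℝ) (A : Finset Ω) : ℝ := ∑ ω ∈ A, p ω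

/-- A valid conditional pmf `k` from `Ω` to (pmfs on) `X`: nonnegative, sums to one,
supported on `X`, and `k A z > 0` with `p z > 0` implies `z ∈ A`. -/
def ValidK [Fintype Ω] (p : Ω → ℝ) (X : Finset (Finset Ω)) (k : Ω → Finset Ω → ℝ) : Prop :=
  (∀ z A, 0 ≤ k z A) ∧ (∀ z, ∑ A : Finset Ω, k z A = 1) ∧
    (∀ z A, 0 < k z A → A ∈ X) ∧ ∀ z A, 0 < p z → 0 < k z A → z ∈ A

/-- The mutual information `I(Z;A)` where `Z ∼ p` and `A | Z ∼ k`. -/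
def MI [Fintype Ω] (p : Ω → ℝ) (k : Ω → Finset Ω → ℝ) : ℝ :=
  ∑ z : Ω, ∑ A : Finset Ω,
    p z * k z A * Real.logb 2 (k z A / ∑ z' : Ω, p z' * k z' A)

/-- The entropy `H(X)` of a hyperconfusion `X` over `(Ω, p)`, valued in `[0,∞]`
(`∞` when no valid conditional pmf exists). -/
def Hent [Fintype Ω] (p : Ω → ℝ) (X : Finset (Finset Ω)) : ℝ≥0∞ :=
  ⨅ (k : Ω → Finset Ω → ℝ) (_ : ValidK p X k), ENNReal.ofReal (MI p k)

/-- `−log₂ x = log₂ (1/x)`, valued in `[0,∞]` (equals `∞` when `x ≤ 0`). -/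
def negLog2 (x : ℝ) : ℝ≥0∞ :=
  if x ≤ 0 then ⊤ else ENNReal.ofReal (Real.logb 2 x⁻¹)

/-- The min-entropy `H∞(X) = −log₂ max_{A ∈ X} p(A)`. -/
def Hmin [Fintype Ω] (p : Ω → ℝ) (X : Finset (Finset Ω)) : ℝ≥0∞ :=
  ⨅ A ∈ X, negLog2 (pset p A)

/-- The integral max-entropy `H₀(X)`: `log₂` of the minimum cardinality of a subfamily
of `X` covering `supp(p)` (`∞` if there is none). -/
def H0ent [Fintype Ω] (p : Ω → ℝ) (X : Finset (Finset Ω)) : ℝ≥0∞ :=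
  ⨅ (S : Finset (Finset Ω))
    (_ : S ⊆ X ∧ ∀ ω : Ω, 0 < p ω → ∃ A ∈ S, ω ∈ A),
    ENNReal.ofReal (Real.logb 2 (S.card : ℝ))

/-- The fractional max-entropy `Hε(X)`: `log₂` of the minimum total weight of a
fractional covering of `supp(p)` by members of `X` (`∞` if there is none). -/
def Heps [Fintype Ω] (p : Ω → ℝ) (X : Finset (Finset Ω)) : ℝ≥0∞ :=
  ⨅ (μ : Finset Ω → ℝ)
    (_ : (∀ A, 0 ≤ μ A) ∧ (∀ A, μ A ≠ 0 → A ∈ X) ∧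
      ∀ ω : Ω, 0 < p ω → 1 ≤ ∑ A ∈ X, if ω ∈ A then μ A else 0),
    ENNReal.ofReal (Real.logb 2 (∑ A ∈ X, μ A))

/-- The support of the pmf `p`. -/
def suppP [Fintype Ω] (p : Ω → ℝ) : Finset Ω := univ.filter fun ω => 0 < p ω

/-- The support of a hyperconfusion: the points whose singleton is confusable. -/
def suppH [Fintype Ω] (X : Finset (Finset Ω)) : Finset Ω :=
  univ.filter fun ω => ({ω} : Finset Ω) ∈ X

/-- `X` is an ordinary information: the union of the powersets of a nonempty collection
of pairwise disjoint subsets of `Ω`. -/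
def IsOI (X : Finset (Finset Ω)) : Prop :=
  ∃ S : Finset (Finset Ω), S.Nonempty ∧
    (∀ A ∈ S, ∀ B ∈ S, A ≠ B → Disjoint A B) ∧
    ∀ C : Finset Ω, C ∈ X ↔ ∃ A ∈ S, C ⊆ A

/-- The Heyting implication `X → Y := {A ⊆ Ω : X ∩ 2^A ⊆ Y}` of hyperconfusions. -/
def himpHyp [Fintype Ω] (X Y : Finset (Finset Ω)) : Finset (Finset Ω) :=
  univ.filter fun A => ∀ B ∈ X, B ⊆ A → B ∈ Y

/-- `log₂` on `[0,∞]`. -/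
def elog2 (x : ℝ≥0∞) : ℝ≥0∞ :=
  if x = ⊤ then ⊤ else ENNReal.ofReal (Real.logb 2 x.toReal)

/-- The maximal members of a hyperconfusion (under inclusion). -/
def maxsHyp (X : Finset (Finset Ω)) : Finset (Finset Ω) :=
  X.filter fun A => ∀ B ∈ X, A ⊆ B → B = A

/-- The indicator vector of `A ⊆ Ω`, as an element of `ℝ^Ω`. -/
def indVec (A : Finset Ω) : Ω → ℝ := fun ω => if ω ∈ A then 1 else 0

/-- The ordinary information `oi(f) = {A : |f(A)| ≤ 1}` induced by a function `f`. -/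
def oiF {Ω' : Type*} [Fintype Ω] (f : Ω → Ω') : Finset (Finset Ω) :=
  univ.filter fun A : Finset Ω => (A.image f).card ≤ 1

/-- Independence of two hyperconfusions: all unions of maximal confusable sets are
independent events. -/
def IndepHyp [Fintype Ω] (p : Ω → ℝ) (X Y : Finset (Finset Ω)) : Prop :=
  ∀ S ⊆ maxsHyp X, ∀ T ⊆ maxsHyp Y,
    pset p ((S.biUnion id) ∩ (T.biUnion id)) =
      pset p (S.biUnion id) * pset p (T.biUnion id)

/-- The embedding `Xᵢ` of a hyperconfusion `X` over `Ω` into the product space `Ωⁿ`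
along coordinate `i`. -/
def embedHyp [Fintype Ω] (X : Finset (Finset Ω)) (n : ℕ) (i : Fin n) :
    Finset (Finset (Fin n → Ω)) :=
  univ.filter fun C => ∃ A ∈ X, ∀ ω ∈ C, ω i ∈ A

/-- The i.i.d. product pmf `p^⊗ⁿ` on `Ωⁿ`. -/
def pPow [Fintype Ω] (p : Ω → ℝ) (n : ℕ) : (Fin n → Ω) → ℝ :=
  fun ω => ∏ i, p (ω i)

/-- The conditional pmf `p(·|E)` (supported on `E`). -/
def condP [Fintype Ω] (p : Ω → ℝ) (E : Finset Ω) : Ω → ℝ :=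
  fun ω => if ω ∈ E then p ω / pset p E else 0

/-- The conditional entropy `H(X|E)` of the hyperconfusion `X ∩ 2^E` over the
conditional probability space `(E, p(·|E))`. -/
def HcondEvent [Fintype Ω] (p : Ω → ℝ) (X : Finset (Finset Ω)) (E : Finset Ω) : ℝ≥0∞ :=
  Hent (condP p E) (X ∩ E.powerset)

/-- The conditional entropy `H(X|Y) := p(E)·(H(X∩Y|E) − H(Y|E))` where `E = supp(Y)`,
taken to be `0` when `p(E) = 0`. -/
def Hcond [Fintype Ω] (p : Ω → ℝ) (X Y : Finset (Finset Ω)) : ℝ≥0∞ :=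
  if pset p (suppH Y) = 0 then 0
  else ENNReal.ofReal (pset p (suppH Y)) *
    (HcondEvent p (X ∩ Y) (suppH Y) - HcondEvent p Y (suppH Y))

/-- The singleton hyperconfusion `sing(Ω) = {∅} ∪ {{ω} : ω ∈ Ω}`. -/
def singHyp (α : Type*) [Fintype α] : Finset (Finset α) :=
  insert ∅ (univ.image fun ω : α => ({ω} : Finset α))

/-- A valid pmf `q` on `Ỹ` for the coarse entropy: supported on `Yt`, and dominating `p`
in the sense that `p(S) ≤ Σ_{B ∈ Yt, S∩B ≠ ∅} q(B)` for all `S`. -/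
def ValidQ [Fintype Ω] (p : Ω → ℝ) (Yt : Finset (Finset Ω)) (q : Finset Ω → ℝ) : Prop :=
  (∀ B, 0 ≤ q B) ∧ (∀ B, q B ≠ 0 → B ∈ Yt) ∧ (∑ B : Finset Ω, q B = 1) ∧
    ∀ S : Finset Ω, pset p S ≤ ∑ B ∈ Yt, if (S ∩ B).Nonempty then q B else 0

/-- A valid conditional pmf `m` from `Ỹ` to `X` for the coarse entropy:
`m A B > 0` with `q B > 0` implies `B ⊆ A`. -/
def ValidM [Fintype Ω] (X : Finset (Finset Ω)) (q : Finset Ω → ℝ)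
    (m : Finset Ω → Finset Ω → ℝ) : Prop :=
  (∀ B A, 0 ≤ m B A) ∧ (∀ B, ∑ A : Finset Ω, m B A = 1) ∧
    (∀ B A, 0 < m B A → A ∈ X) ∧ ∀ B A, 0 < q B → 0 < m B A → B ⊆ A

/-- The mutual information `I(B;A)` where `B ∼ q` and `A | B ∼ m`. -/
def MI2 [Fintype Ω] (q : Finset Ω → ℝ) (m : Finset Ω → Finset Ω → ℝ) : ℝ :=
  ∑ B : Finset Ω, ∑ A : Finset Ω,
    q B * m B A * Real.logb 2 (m B A / ∑ B' : Finset Ω, q B' * m B' A)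

/-- The coarse entropy `H(X ↘ Y)` of `X` with respect to `Y`. -/
def Hcoarse [Fintype Ω] (p : Ω → ℝ) (X Y : Finset (Finset Ω)) : ℝ≥0∞ :=
  if Y ∪ singHyp Ω ⊆ X then
    ⨆ (q : Finset Ω → ℝ) (_ : ValidQ p (Y ∪ singHyp Ω) q),
      ⨅ (m : Finset Ω → Finset Ω → ℝ) (_ : ValidM X q m), ENNReal.ofReal (MI2 q m)
  else ⊤

/-- The capacity `C(X) = max_p H(X)` of a hyperconfusion. -/
def capacity [Fintype Ω] (X : Finset (Finset Ω)) : ℝ≥0∞ :=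
  ⨆ (p : Ω → ℝ) (_ : IsPMF p), Hent p X

/-- The product hyperconfusion `X ⊗ Y` over `Ω × Γ`. -/
def prodHyp {Γ : Type*} [Fintype Ω] [Fintype Γ]
    (X : Finset (Finset Ω)) (Y : Finset (Finset Γ)) : Finset (Finset (Ω × Γ)) :=
  univ.filter fun C => ∃ A ∈ X, ∃ B ∈ Y, ∀ c ∈ C, c.1 ∈ A ∧ c.2 ∈ B

/-- The `n`-fold product hyperconfusion `X^⊗ⁿ` over `Ωⁿ`. -/
def powHyp [Fintype Ω] (X : Finset (Finset Ω)) (n : ℕ) : Finset (Finset (Fin n → Ω)) :=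
  univ.filter fun C => ∃ A : Fin n → Finset Ω, (∀ i, A i ∈ X) ∧ ∀ ω ∈ C, ∀ i, ω i ∈ A i

/-- `X ⊑ Y`: there is a surjective hyperconfusable set-valued function from `(Ω,X)`
to `(Γ,Y)`. -/
def ConfusesOnto {Γ : Type*} [Fintype Ω] [Fintype Γ]
    (X : Finset (Finset Ω)) (Y : Finset (Finset Γ)) : Prop :=
  ∃ β : Ω → Finset Γ, (∀ A ∈ X, A.biUnion β ∈ Y) ∧ univ.biUnion β = univ

/-- The confusion ratio `CR(X/Y) = sup{m/n : X^⊗ⁿ ⊑ Y^⊗ᵐ}`. -/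
def confRatio {Γ : Type*} [Fintype Ω] [Fintype Γ]
    (X : Finset (Finset Ω)) (Y : Finset (Finset Γ)) : ℝ≥0∞ :=
  ⨆ (n : ℕ) (m : ℕ)
    (_ : 0 < n ∧ 0 < m ∧ ConfusesOnto (powHyp X n) (powHyp Y m)),
    (m : ℝ≥0∞) / (n : ℝ≥0∞)

lemma pos_log2 : 0 < Real.log 2 := Real.log_pos (by norm_num)

/-- Mutual information dominates `E log (1/q_z)`. -/
lemma MI_ge [Fintype Ω] (p : Ω → ℝ) (hp : IsPMF p) (X : Finset (Finset Ω))
    (k : Ω → Finset Ω → ℝ) (hk : ValidK p X k) (w : Finset Ω → ℝ)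
    (hw : ∀ A, w A = ∑ z', p z' * k z' A) (q : Ω → ℝ)
    (hq : ∀ z, q z = ∑ A : Finset Ω, if z ∈ A then w A else 0)
    (hqpos : ∀ z, 0 < p z → 0 < q z) :
    ∑ z ∈ suppP p, p z * Real.logb 2 (1 / q z) ≤ MI p k := by
  obtain ⟨hk0, hk1, hkX, hkz⟩ := hk
  have hw0 : ∀ A, 0 ≤ w A := fun A => by
    rw [hw]; exact Finset.sum_nonneg fun z _ => mul_nonneg (hp.1 z) (hk0 z A)
  have hMI : MI p k = ∑ z ∈ suppP p, ∑ A : Finset Ω, p z * k z A * Real.logb 2 (k z A / w A) := by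
    unfold MI
    simp only [← hw]
    symm
    apply Finset.sum_subset (Finset.subset_univ _)
    intro z _ hz
    have : p z = 0 := by
      simp only [suppP, mem_filter, mem_univ, true_and, not_lt] at hz
      exact le_antisymm hz (hp.1 z)
    simp [this]
  rw [hMI]
  apply Finset.sum_le_sum
  intro z hz
  have hpz : 0 < p z := by simpa [suppP] using hz
  have hqz := hqpos z hpz
  simp only [mul_assoc]
  rw [← Finset.mul_sum]
  apply mul_le_mul_of_nonneg_left _ hpz.le
  have key : ∀ A : Finset Ω, k z A - (if z ∈ A then w A else 0) / q z ≤
      k z A * (Real.log (k z A / w A) + Real.log (q z)) := by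
    intro A
    rcases (hk0 z A).eq_or_lt with h | h
    · rw [← h]
      have : 0 ≤ (if z ∈ A then w A else 0) / q z := by
        apply div_nonneg _ hqz.le
        split_ifs <;> simp [hw0]
      simp only [zero_mul]; linarith
    · have hzA := hkz z A hpz h
      have hwA : 0 < w A := by
        rw [hw]
        refine lt_of_lt_of_le (mul_pos hpz h) ?_
        exact Finset.single_le_sum (f := fun z' => p z' * k z' A)
          (fun z _ => mul_nonneg (hp.1 z) (hk0 z A)) (Finset.mem_univ z)
      rw [if_pos hzA, ← Real.log_mul (by positivity) (by positivity)]
      have h1 := Real.one_sub_inv_le_log_of_pos (x := k z A / w A * q z) (by positivity)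
      have h2 := mul_le_mul_of_nonneg_left h1 h.le
      refine le_trans (le_of_eq ?_) h2
      field_simp
  have hs := Finset.sum_le_sum (s := Finset.univ) fun A _ => key A
  rw [Finset.sum_sub_distrib, hk1, ← Finset.sum_div, ← hq, div_self hqz.ne', sub_self] at hs
  simp only [mul_add, Finset.sum_add_distrib] at hs
  rw [← Finset.sum_mul, hk1, one_mul] at hs
  have e : ∑ A : Finset Ω, k z A * Real.logb 2 (k z A / w A) =
      (∑ A : Finset Ω, k z A * Real.log (k z A / w A)) / Real.log 2 := by
    rw [Finset.sum_div]
    exact Finset.sum_congr rfl fun A _ => by rw [Real.logb, mul_div_assoc]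
  rw [e, Real.logb, one_div, Real.log_inv]
  exact (div_le_div_iff_of_pos_right pos_log2).2 (by linarith)

/-- One step concavity estimate. -/
lemma log_step (t q : ℝ) (ht : 0 ≤ t) (hq : 0 < q) (hq1 : q ≤ 1) :
    q * Real.log (t + 1) + (1 - q) * Real.log (t + 1 + 1 / q) ≤ Real.log (t + 1 / q) := by
  have hc := strictConcaveOn_log_Ioi.concaveOn
  have h1q : 0 < 1 / q := by positivity
  have := hc.2 (x := t + 1) (y := t + 1 + 1 / q) (by simp; linarith)
    (by simp only [Set.mem_Ioi]; linarith) hq.le (sub_nonneg.2 hq1) (by ring)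
  simp only [smul_eq_mul] at this
  refine this.trans (le_of_eq ?_)
  congr 1
  field_simp
  ring

lemma greedy [Fintype Ω] (p : Ω → ℝ) (X : Finset (Finset Ω)) (hX0 : X.Nonempty)
    (w : Finset Ω → ℝ) (hw0 : ∀ A, 0 ≤ w A) (hw1 : ∑ A : Finset Ω, w A = 1)
    (hwX : ∀ A, 0 < w A → A ∈ X) (q : Ω → ℝ)
    (hq : ∀ z, q z = ∑ A : Finset Ω, if z ∈ A then w A else 0) :
    ∀ (n : ℕ) (U : Finset Ω), U.card = n → (∀ z ∈ U, 0 < p z ∧ 0 < q z) → ∀ t : ℕ,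
    ∃ (K : Ω → ℕ) (B : ℕ → Finset Ω), (∀ z, t + 1 ≤ K z) ∧ (∀ j, B j ∈ X) ∧
      (∀ z ∈ U, z ∈ B (K z)) ∧
      ∑ z ∈ U, p z * Real.log (K z) ≤ ∑ z ∈ U, p z * Real.log (t + 1 / q z) := by
  intro n
  induction n using Nat.strong_induction_on with
  | _ n ih =>
  intro U hUn hU t
  rcases U.eq_empty_or_nonempty with rfl | hne
  · obtain ⟨A0, hA0⟩ := hX0
    exact ⟨fun _ => t + 1, fun _ => A0, by simp, by simp [hA0], by simp, by simp⟩
  have hq1 : ∀ z, q z ≤ 1 := fun z => by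
    rw [hq, ← hw1]
    exact Finset.sum_le_sum fun A _ => by split_ifs <;> simp [hw0]
  have ht0 : (0 : ℝ) ≤ t := Nat.cast_nonneg t
  -- potential
  set Φ : Finset Ω → ℝ := fun A => ∑ z ∈ U, p z *
    (if z ∈ A then Real.log (t + 1) else Real.log (t + 1 + 1 / q z)) with hΦ
  set R : ℝ := ∑ z ∈ U, p z * Real.log (t + 1 / q z) with hR
  have havg : ∑ A : Finset Ω, w A * Φ A ≤ R := by
    have : ∑ A : Finset Ω, w A * Φ A = ∑ z ∈ U, p z *
        (q z * Real.log (t + 1) + (1 - q z) * Real.log (t + 1 + 1 / q z)) := by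
      simp only [hΦ, Finset.mul_sum]
      rw [Finset.sum_comm]
      refine Finset.sum_congr rfl fun z _ => ?_
      have e1 : (1 - q z) = ∑ A : Finset Ω, (w A - if z ∈ A then w A else 0) := by
        rw [Finset.sum_sub_distrib, hw1, hq]
      rw [e1, hq z, Finset.sum_mul, Finset.sum_mul, ← Finset.sum_add_distrib, Finset.mul_sum]
      refine Finset.sum_congr rfl fun A _ => ?_
      split_ifs <;> ring
    rw [this]
    exact Finset.sum_le_sum fun z hz =>
      mul_le_mul_of_nonneg_left (log_step t (q z) ht0 (hU z hz).2 (hq1 z)) (hU z hz).1.le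
  obtain ⟨A, hA, hAR⟩ : ∃ A, 0 < w A ∧ Φ A ≤ R := by
    by_contra! hcon
    have hlt : ∑ A : Finset Ω, w A * R < ∑ A : Finset Ω, w A * Φ A := by
      apply Finset.sum_lt_sum
      · intro A _
        rcases (hw0 A).eq_or_lt with h | h
        · simp [← h]
        · exact mul_le_mul_of_nonneg_left (hcon A h).le h.le
      · have : ∃ A : Finset Ω, 0 < w A := by
          by_contra! hn
          have : ∑ A : Finset Ω, w A ≤ 0 := Finset.sum_nonpos fun A _ => hn A
          linarith
        obtain ⟨A, h⟩ := this
        exact ⟨A, Finset.mem_univ _, mul_lt_mul_of_pos_left (hcon A h) h⟩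
    rw [← Finset.sum_mul, hw1, one_mul] at hlt
    linarith
  have hmeet : ∃ z ∈ U, z ∈ A := by
    by_contra! hn
    have : R < Φ A := by
      apply Finset.sum_lt_sum_of_nonempty hne
      intro z hz
      rw [if_neg (hn z hz)]
      have := (hU z hz).2
      apply mul_lt_mul_of_pos_left _ (hU z hz).1
      apply Real.log_lt_log
      · positivity
      · linarith
    linarith
  obtain ⟨z0, hz0, hz0A⟩ := hmeet
  have hcard : (U.filter (fun z => z ∉ A)).card < n := by
    rw [← hUn]
    apply Finset.card_lt_card
    rw [Finset.filter_ssubset]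
    exact ⟨z0, hz0, by simpa using hz0A⟩
  obtain ⟨K, B, hK, hB, hKB, hsum⟩ := ih _ hcard (U.filter (fun z => z ∉ A)) rfl
    (fun z hz => hU z (Finset.mem_filter.1 hz).1) (t + 1)
  refine ⟨fun z => if z ∈ A then t + 1 else K z, fun j => if j = t + 1 then A else B j,
    ?_, ?_, ?_, ?_⟩
  · intro z
    have := hK z
    dsimp only
    split_ifs <;> omega
  · intro j
    dsimp only
    split_ifs
    · exact hwX A hA
    · exact hB j
  · intro z hz
    dsimp only
    by_cases h : z ∈ A
    · simp [h]
    · have := hK z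
      rw [if_neg h, if_neg (by omega)]
      exact hKB z (by simp [hz, h])
  · refine le_trans ?_ hAR
    simp only [hΦ]
    rw [← Finset.sum_filter_add_sum_filter_not U (fun z => z ∈ A),
      ← Finset.sum_filter_add_sum_filter_not U (fun z => z ∈ A)
        (fun z => p z * (if z ∈ A then Real.log (t + 1) else Real.log (t + 1 + 1 / q z)))]
    apply add_le_add
    · apply le_of_eq
      refine Finset.sum_congr rfl fun z hz => ?_
      simp [(Finset.mem_filter.1 hz).2]
    · refine le_trans (le_of_eq ?_) (hsum.trans (le_of_eq ?_))
      · refine Finset.sum_congr rfl fun z hz => ?_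
        simp [(Finset.mem_filter.1 hz).2]
      · refine Finset.sum_congr rfl fun z hz => ?_
        simp [(Finset.mem_filter.1 hz).2]

/-- Deterministic encoders: Gibbs bound. -/
lemma Hent_le_det {ι : Type*} [DecidableEq ι] [Fintype Ω] (p : Ω → ℝ) (hp : IsPMF p) (M : Finset (Finset Ω))
    (g : Ω → ι) (F : ι → Finset Ω) (hM : ∀ z, F (g z) ∈ M) (hz : ∀ z, 0 < p z → z ∈ F (g z))
    (Q : ι → ℝ) (hQ : ∀ z, 0 < Q (g z)) (hQ1 : ∑ j ∈ univ.image g, Q j ≤ 1) :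
    Hent p M ≤ ENNReal.ofReal (∑ z ∈ suppP p, p z * - Real.logb 2 (Q (g z))) := by
  set k : Ω → Finset Ω → ℝ := fun z A => if A = F (g z) then 1 else 0 with hkdef
  have hk : ValidK p M k := by
    refine ⟨?_, ?_, ?_, ?_⟩
    · intro z A; simp only [hkdef]; split_ifs <;> norm_num
    · intro z; simp [hkdef]
    · intro z A h
      simp only [hkdef] at h
      split_ifs at h with h1
      · rw [h1]; exact hM z
      · exact absurd h (lt_irrefl _)
    · intro z A hpz h
      simp only [hkdef] at h
      split_ifs at h with h1
      · rw [h1]; exact hz z hpz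
      · exact absurd h (lt_irrefl _)
  refine (iInf₂_le k hk).trans (ENNReal.ofReal_le_ofReal ?_)
  set P : ι → ℝ := fun j => ∑ z, if g z = j then p z else 0 with hP
  have hPpos : ∀ z, 0 < p z → 0 < P (g z) := by
    intro z h
    refine lt_of_lt_of_le h ?_
    have := Finset.single_le_sum (f := fun z' => if g z' = g z then p z' else 0) (s := univ)
      (fun z' _ => by split_ifs <;> simp [hp.1]) (Finset.mem_univ z)
    simpa using this
  have hMI : MI p k ≤ ∑ z ∈ suppP p, p z * - Real.logb 2 (P (g z)) := by
    have e : MI p k = ∑ z ∈ suppP p, p z * Real.logb 2 (1 / ∑ z', p z' * k z' (F (g z))) := by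
      unfold MI
      symm
      rw [← Finset.sum_subset (Finset.subset_univ (suppP p))]
      · refine Finset.sum_congr rfl fun z _ => ?_
        rw [Finset.sum_eq_single (F (g z))]
        · simp [hkdef]
        · intro A _ hA; simp [hkdef, hA]
        · simp
      · intro z _ hz
        have : p z = 0 := by
          simp only [suppP, mem_filter, mem_univ, true_and, not_lt] at hz
          exact le_antisymm hz (hp.1 z)
        simp [this]
    rw [e]
    refine Finset.sum_le_sum fun z hz' => ?_
    have hpz : 0 < p z := by simpa [suppP] using hz'
    apply mul_le_mul_of_nonneg_left _ hpz.le
    rw [one_div, Real.logb_inv, neg_le_neg_iff]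
    apply Real.logb_le_logb_of_le (by norm_num) (hPpos z hpz)
    refine Finset.sum_le_sum fun z' _ => ?_
    simp only [hkdef]
    split_ifs with h1 h2 h2
    · simp
    · rw [h1] at h2; simp at h2
    · simp [hp.1]
    · simp
  refine hMI.trans ?_
  have key : ∀ z ∈ suppP p, p z * - Real.logb 2 (P (g z)) ≤ p z * - Real.logb 2 (Q (g z)) +
      (p z * (Q (g z) / P (g z)) - p z) / Real.log 2 := by
    intro z hz'
    have hpz : 0 < p z := by simpa [suppP] using hz'
    have h1 := hPpos z hpz
    have h2 := hQ z
    have h3 := Real.log_le_sub_one_of_pos (x := Q (g z) / P (g z)) (by positivity)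
    rw [Real.log_div h2.ne' h1.ne'] at h3
    have h4 := mul_le_mul_of_nonneg_left h3 hpz.le
    have e : p z * - Real.logb 2 (Q (g z)) + (p z * (Q (g z) / P (g z)) - p z) / Real.log 2 =
      (p z * - Real.log (Q (g z)) + (p z * (Q (g z) / P (g z)) - p z)) / Real.log 2 := by
      rw [Real.logb]; ring
    have e2 : p z * - Real.logb 2 (P (g z)) = (p z * - Real.log (P (g z))) / Real.log 2 := by
      rw [Real.logb]; ring
    rw [e, e2]
    exact (div_le_div_iff_of_pos_right pos_log2).2 (by linarith)
  have hs := Finset.sum_le_sum key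
  rw [Finset.sum_add_distrib, ← Finset.sum_div, Finset.sum_sub_distrib] at hs
  have hsupp : ∀ f : Ω → ℝ, ∑ z ∈ suppP p, p z * f z = ∑ z, p z * f z := by
    intro f
    apply Finset.sum_subset (Finset.subset_univ (suppP p))
    intro z _ hz
    have : p z = 0 := by
      simp only [suppP, mem_filter, mem_univ, true_and, not_lt] at hz
      exact le_antisymm hz (hp.1 z)
    simp [this]
  have hs1 : ∑ z ∈ suppP p, p z = 1 := by
    have := hsupp (fun _ => 1)
    simpa [hp.2] using this
  have hs2 : ∑ z ∈ suppP p, p z * (Q (g z) / P (g z)) ≤ 1 := by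
    rw [hsupp (fun z => Q (g z) / P (g z))]
    refine le_trans ?_ hQ1
    rw [← Finset.sum_fiberwise_of_maps_to (s := univ) (t := univ.image g) (g := g)
      (fun z _ => Finset.mem_image_of_mem g (Finset.mem_univ z))]
    refine Finset.sum_le_sum fun j hj => ?_
    have e : ∑ z ∈ univ.filter (fun z => g z = j), p z * (Q (g z) / P (g z)) =
        P j * (Q j / P j) := by
      simp only [hP]
      rw [← Finset.sum_filter, Finset.sum_mul]
      refine Finset.sum_congr rfl fun z hz => ?_
      rw [(Finset.mem_filter.1 hz).2, ← Finset.sum_filter]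
    rw [e]
    obtain ⟨z, _, rfl⟩ := Finset.mem_image.1 hj
    rcases eq_or_ne (P (g z)) 0 with h | h
    · rw [h]; simp [(hQ z).le]
    · rw [mul_div_cancel₀ _ h]
  have : (∑ z ∈ suppP p, p z * (Q (g z) / P (g z)) - ∑ z ∈ suppP p, p z) / Real.log 2 ≤ 0 :=
    div_nonpos_of_nonpos_of_nonneg (by linarith) pos_log2.le
  linarith

/-- Zeta-type partial sum bound. -/
lemma zeta_partial (s : ℝ) (hs : 0 < s) (N : ℕ) :
    ∑ j ∈ Finset.Icc 1 (N + 1), ((j : ℝ) ^ (-(1 + s))) ≤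
      1 + (1 - ((N + 1 : ℕ) : ℝ) ^ (-s)) / s := by
  induction N with
  | zero => simp
  | succ N ih =>
    rw [Finset.sum_Icc_succ_top (by omega)]
    set x : ℝ := ((N + 1 : ℕ) : ℝ) with hx
    have hx0 : 0 < x := by rw [hx]; positivity
    have e : ((N + 1 + 1 : ℕ) : ℝ) = x + 1 := by rw [hx]; push_cast; ring
    rw [e]
    have key : s * (x + 1) ^ (-(1 + s)) ≤ x ^ (-s) - (x + 1) ^ (-s) := by
      have hy : 0 < x + 1 := by linarith
      have e1 : (x + 1) ^ (-(1 + s)) = (x + 1) ^ (-s) / (x + 1) := by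
        rw [show -(1 + s) = -s - 1 by ring, Real.rpow_sub_one hy.ne']
      have e2 : x ^ (-s) = (x + 1) ^ (-s) * (x / (x + 1)) ^ (-s) := by
        rw [← Real.mul_rpow hy.le (by positivity)]
        congr 1
        field_simp
      have h3 : 1 + s / (x + 1) ≤ (x / (x + 1)) ^ (-s) := by
        rw [Real.rpow_def_of_pos (by positivity)]
        have hl := Real.log_le_sub_one_of_pos (x := x / (x + 1)) (by positivity)
        have h4 : x / (x + 1) - 1 = - (1 / (x + 1)) := by field_simp; ring
        rw [h4] at hl
        have h5 := mul_le_mul_of_nonneg_left hl hs.le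
        have h6 := Real.add_one_le_exp (Real.log (x / (x + 1)) * -s)
        have h7 : s * -(1 / (x + 1)) = - (s / (x + 1)) := by ring
        linarith
      have hpos : 0 < (x + 1) ^ (-s) := Real.rpow_pos_of_pos hy _
      have h8 := mul_le_mul_of_nonneg_left h3 hpos.le
      rw [e1, e2]
      have : s * ((x + 1) ^ (-s) / (x + 1)) = (x + 1) ^ (-s) * (s / (x + 1)) := by ring
      linarith
    have key2 : (x + 1) ^ (-(1 + s)) ≤ (x ^ (-s) - (x + 1) ^ (-s)) / s := by
      rw [le_div_iff₀ hs]; linarith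
    have : (1 - (x + 1) ^ (-s)) / s = (1 - x ^ (-s)) / s + (x ^ (-s) - (x + 1) ^ (-s)) / s := by
      ring
    linarith

lemma zeta_finite (s : ℝ) (hs : 0 < s) (T : Finset ℕ) (hT : ∀ j ∈ T, 1 ≤ j) :
    ∑ j ∈ T, ((j : ℝ) ^ (-(1 + s))) ≤ 1 + 1 / s := by
  have hsub : T ⊆ Finset.Icc 1 (T.sup id + 1) := by
    intro j hj
    have := Finset.le_sup (f := id) hj
    simp only [id] at this
    rw [Finset.mem_Icc]
    exact ⟨hT j hj, by omega⟩
  refine (Finset.sum_le_sum_of_subset_of_nonneg hsub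
    (fun j _ _ => Real.rpow_nonneg (Nat.cast_nonneg j) _)).trans ?_
  refine (zeta_partial s hs _).trans ?_
  have : (0 : ℝ) ≤ ((T.sup id + 1 : ℕ) : ℝ) ^ (-s) := Real.rpow_nonneg (Nat.cast_nonneg _) _
  have := (div_le_div_iff_of_pos_right hs).2 (show 1 - ((T.sup id + 1 : ℕ) : ℝ) ^ (-s) ≤ 1 by linarith)
  linarith

/-- Ordinary information from labels. -/
def mkOI {ι : Type*} [DecidableEq ι] [Fintype Ω] (U : Finset Ω) (g : Ω → ι) (T : Finset ι) :
    Finset (Finset Ω) :=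
  univ.filter fun C => ∃ j ∈ T, C ⊆ U.filter (fun z => g z = j)

lemma mkOI_isOI {ι : Type*} [DecidableEq ι] [Fintype Ω] (U : Finset Ω) (g : Ω → ι) (T : Finset ι)
    (hT : T.Nonempty) : IsOI (mkOI U g T) := by
  refine ⟨T.image fun j => U.filter (fun z => g z = j), hT.image _, ?_, ?_⟩
  · intro A hA B hB hAB
    obtain ⟨i, _, rfl⟩ := Finset.mem_image.1 hA
    obtain ⟨j, _, rfl⟩ := Finset.mem_image.1 hB
    have hij : i ≠ j := fun h => hAB (by rw [h])
    rw [Finset.disjoint_left]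
    intro z h1 h2
    exact hij ((Finset.mem_filter.1 h1).2.symm.trans (Finset.mem_filter.1 h2).2)
  · intro C
    simp [mkOI]

lemma OI_down {M : Finset (Finset Ω)} (h : IsOI M) : ∀ A ∈ M, ∀ B ⊆ A, B ∈ M := by
  obtain ⟨S, _, _, h⟩ := h
  intro A hA B hB
  obtain ⟨C, hC, hAC⟩ := (h A).1 hA
  exact (h B).2 ⟨C, hC, hB.trans hAC⟩

lemma feas_sub [Fintype Ω] {X Y M : Finset (Finset Ω)}
    (h : IsOI M ∧ X ∩ M ⊆ Y ∧ Y ∩ M ⊆ X) : M ⊆ himpHyp X Y ∩ himpHyp Y X := by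
  obtain ⟨h1, h2, h3⟩ := h
  intro A hA
  simp only [himpHyp, Finset.mem_inter, Finset.mem_filter, Finset.mem_univ, true_and]
  exact ⟨fun B hB hBA => h2 (Finset.mem_inter.2 ⟨hB, OI_down h1 A hA B hBA⟩),
    fun B hB hBA => h3 (Finset.mem_inter.2 ⟨hB, OI_down h1 A hA B hBA⟩)⟩

lemma feas_of_sub [Fintype Ω] {X Y M : Finset (Finset Ω)} (h1 : IsOI M)
    (h : M ⊆ himpHyp X Y ∩ himpHyp Y X) : IsOI M ∧ X ∩ M ⊆ Y ∧ Y ∩ M ⊆ X := by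
  refine ⟨h1, ?_, ?_⟩ <;> intro A hA <;> rw [Finset.mem_inter] at hA <;> have := h hA.2 <;>
    simp only [himpHyp, Finset.mem_inter, Finset.mem_filter, Finset.mem_univ, true_and] at this
  · exact this.1 A hA.1 subset_rfl
  · exact this.2 A hA.1 subset_rfl

lemma star_down [Fintype Ω] {X Y : Finset (Finset Ω)} :
    ∀ A ∈ himpHyp X Y ∩ himpHyp Y X, ∀ B ⊆ A, B ∈ himpHyp X Y ∩ himpHyp Y X := by
  intro A hA B hBA
  simp only [himpHyp, Finset.mem_inter, Finset.mem_filter, Finset.mem_univ, true_and] at hA ⊢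
  exact ⟨fun C hC h => hA.1 C hC (h.trans hBA), fun C hC h => hA.2 C hC (h.trans hBA)⟩

lemma Hent_mono [Fintype Ω] (p : Ω → ℝ) {M N : Finset (Finset Ω)} (h : M ⊆ N) :
    Hent p N ≤ Hent p M :=
  le_iInf₂ fun k hk => iInf₂_le k ⟨hk.1, hk.2.1, fun z A hA => h (hk.2.2.1 z A hA), hk.2.2.2⟩

lemma H0_mono [Fintype Ω] (p : Ω → ℝ) {M N : Finset (Finset Ω)} (h : M ⊆ N) :
    H0ent p N ≤ H0ent p M :=
  le_iInf₂ fun S hS => iInf₂_le S ⟨hS.1.trans h, hS.2⟩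

lemma exists_pos [Fintype Ω] {p : Ω → ℝ} (hp : IsPMF p) : ∃ z, 0 < p z := by
  by_contra! h
  have : ∑ z, p z ≤ 0 := Finset.sum_nonpos fun z _ => h z
  rw [hp.2] at this
  linarith

lemma sum_supp [Fintype Ω] {p : Ω → ℝ} (hp : IsPMF p) : ∑ z ∈ suppP p, p z = 1 := by
  rw [← hp.2]
  apply Finset.sum_subset (Finset.subset_univ (suppP p))
  intro z _ hz
  simp only [suppP, mem_filter, mem_univ, true_and, not_lt] at hz
  exact le_antisymm hz (hp.1 z)

lemma cover_choice [Fintype Ω] {p : Ω → ℝ} (hp : IsPMF p) {S : Finset (Finset Ω)}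
    (hS : ∀ ω : Ω, 0 < p ω → ∃ A ∈ S, ω ∈ A) :
    ∃ c : Ω → Finset Ω, (∀ z, c z ∈ S) ∧ ∀ z, 0 < p z → z ∈ c z := by
  obtain ⟨z0, h0⟩ := exists_pos hp
  obtain ⟨A0, hA0, _⟩ := hS z0 h0
  have : ∀ z, ∃ A ∈ S, 0 < p z → z ∈ A := by
    intro z
    by_cases h : 0 < p z
    · obtain ⟨A, hA, hz⟩ := hS z h
      exact ⟨A, hA, fun _ => hz⟩
    · exact ⟨A0, hA0, fun h' => absurd h' h⟩
  choose c h1 h2 using this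
  exact ⟨c, h1, h2⟩

lemma Hent_le_H0 [Fintype Ω] (p : Ω → ℝ) (hp : IsPMF p) (M : Finset (Finset Ω)) :
    Hent p M ≤ H0ent p M := by
  refine le_iInf₂ fun S hS => ?_
  obtain ⟨c, hc, hcz⟩ := cover_choice hp hS.2
  obtain ⟨z0, h0⟩ := exists_pos hp
  have hcard : (0 : ℝ) < S.card := by
    exact_mod_cast Finset.card_pos.2 ⟨c z0, hc z0⟩
  refine (Hent_le_det p hp M c id (fun z => hS.1 (hc z)) hcz (fun _ => 1 / (S.card : ℝ))
    (fun _ => by positivity) ?_).trans (le_of_eq ?_)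
  · have : ((univ.image c).card : ℝ) ≤ S.card := by
      exact_mod_cast Finset.card_le_card (by
        intro A hA
        obtain ⟨z, _, rfl⟩ := Finset.mem_image.1 hA
        exact hc z)
    rw [Finset.sum_const, nsmul_eq_mul, mul_one_div, div_le_one hcard]
    exact this
  · rw [← Finset.sum_mul, sum_supp hp, one_mul, one_div, Real.logb_inv, neg_neg]

/-- Main quantitative step. -/
lemma main_step [Fintype Ω] (p : Ω → ℝ) (hp : IsPMF p) (N : Finset (Finset Ω))
    (hN : ∀ A ∈ N, ∀ B ⊆ A, B ∈ N) (k : Ω → Finset Ω → ℝ) (hk : ValidK p N k)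
    (a : ℝ) (ha : 0 < a) :
    ∃ M, IsOI M ∧ M ⊆ N ∧
      Hent p M ≤ ENNReal.ofReal ((1 + 1 / a) * MI p k + Real.logb 2 (1 + a)) := by
  obtain ⟨w, hw⟩ : ∃ w : Finset Ω → ℝ, ∀ A, w A = ∑ z', p z' * k z' A := ⟨_, fun _ => rfl⟩
  obtain ⟨q, hq⟩ : ∃ q : Ω → ℝ, ∀ z, q z = ∑ A : Finset Ω, if z ∈ A then w A else 0 :=
    ⟨_, fun _ => rfl⟩
  obtain ⟨z0, h0⟩ := exists_pos hp
  have hw0 : ∀ A, 0 ≤ w A := fun A => by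
    rw [hw]; exact Finset.sum_nonneg fun z _ => mul_nonneg (hp.1 z) (hk.1 z A)
  have hw1 : ∑ A : Finset Ω, w A = 1 := by
    simp only [hw]
    rw [Finset.sum_comm]
    simp only [← Finset.mul_sum, hk.2.1, mul_one, hp.2]
  have hwN : ∀ A, 0 < w A → A ∈ N := by
    intro A h
    rw [hw] at h
    obtain ⟨z, _, hz⟩ := Finset.exists_lt_of_sum_lt (f := fun _ : Ω => (0 : ℝ)) (by simpa using h)
    exact hk.2.2.1 z A (pos_of_mul_pos_right hz (hp.1 z))
  have hkpos : ∀ z, ∃ A, 0 < k z A := by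
    intro z
    by_contra! h
    have : ∑ A : Finset Ω, k z A ≤ 0 := Finset.sum_nonpos fun A _ => h A
    rw [hk.2.1] at this
    linarith
  have hqpos : ∀ z, 0 < p z → 0 < q z := by
    intro z hz
    obtain ⟨A, hA⟩ := hkpos z
    have hzA := hk.2.2.2 z A hz hA
    rw [hq]
    have h1 := Finset.single_le_sum (f := fun A : Finset Ω => if z ∈ A then w A else 0) (s := univ)
      (fun A _ => by split_ifs <;> simp [hw0]) (Finset.mem_univ A)
    simp only [if_pos hzA] at h1
    refine lt_of_lt_of_le ?_ h1
    rw [hw]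
    exact lt_of_lt_of_le (mul_pos hz hA) (Finset.single_le_sum (f := fun z' => p z' * k z' A)
      (fun z _ => mul_nonneg (hp.1 z) (hk.1 z A)) (Finset.mem_univ z))
  have hN0 : N.Nonempty := by
    obtain ⟨A, hA⟩ := hkpos z0
    exact ⟨A, hk.2.2.1 z0 A hA⟩
  obtain ⟨K, B, hK, hB, hKB, hsum⟩ := greedy p N hN0 w hw0 hw1 hwN q hq _ (suppP p) rfl
    (fun z hz => by
      have : 0 < p z := by simpa [suppP] using hz
      exact ⟨this, hqpos z this⟩) 0
  have hMIge := MI_ge p hp N k hk w hw q hq hqpos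
  have hlogK : ∑ z ∈ suppP p, p z * Real.logb 2 (K z) ≤ MI p k := by
    refine le_trans ?_ hMIge
    simp only [Real.logb, ← mul_div_assoc, ← Finset.sum_div]
    refine (div_le_div_iff_of_pos_right pos_log2).2 ?_
    simpa using hsum
  refine ⟨mkOI (suppP p) K (univ.image K), mkOI_isOI _ _ _ ⟨K z0, by simp⟩, ?_, ?_⟩
  · intro C hC
    simp only [mkOI, Finset.mem_filter, Finset.mem_univ, true_and] at hC
    obtain ⟨j, _, hC⟩ := hC
    refine hN _ (hB j) _ (hC.trans ?_)
    intro z hz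
    obtain ⟨h1, rfl⟩ := Finset.mem_filter.1 hz
    exact hKB z h1
  · have hKpos : ∀ z, (0 : ℝ) < K z := fun z => by
      have := hK z
      exact_mod_cast (by omega : 0 < K z)
    refine (Hent_le_det p hp _ K (fun j => (suppP p).filter (fun z => K z = j)) ?_ ?_
      (fun j => (j : ℝ) ^ (-(1 + 1 / a)) / (1 + a)) ?_ ?_).trans (ENNReal.ofReal_le_ofReal ?_)
    · intro z
      simp only [mkOI, Finset.mem_filter, Finset.mem_univ, true_and]
      exact ⟨K z, by simp, subset_rfl⟩
    · intro z hz
      simp [suppP, hz]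
    · intro z
      have := Real.rpow_pos_of_pos (hKpos z) (-(1 + 1 / a))
      positivity
    · rw [← Finset.sum_div, div_le_one (by positivity)]
      have := zeta_finite (1 / a) (by positivity) (univ.image K) (by
        intro j hj
        obtain ⟨z, _, rfl⟩ := Finset.mem_image.1 hj
        have := hK z
        omega)
      simpa using this
    · have e : ∀ z ∈ suppP p, p z * -Real.logb 2 ((K z : ℝ) ^ (-(1 + 1 / a)) / (1 + a)) =
          (1 + 1 / a) * (p z * Real.logb 2 (K z)) + p z * Real.logb 2 (1 + a) := by
        intro z _
        have := Real.rpow_pos_of_pos (hKpos z) (-(1 + 1 / a))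
        rw [Real.logb_div this.ne' (by positivity), Real.logb_rpow_eq_mul_logb_of_pos (hKpos z)]
        ring
      rw [Finset.sum_congr rfl e, Finset.sum_add_distrib, ← Finset.mul_sum, ← Finset.sum_mul,
        sum_supp hp, one_mul]
      have := mul_le_mul_of_nonneg_left hlogK (show 0 ≤ 1 + 1 / a by positivity)
      linarith


/-- **Butterfly network.** With `M* = (X→Y) ∩ (Y→X)`,
the optimal ordinary-information entropy `H*` satisfies
`H(M*) ≤ H* ≤ H(M*) + log₂(H(M*) + 3.4) + 1`, and `H* ≤ H₀* = H₀(M*)`. -/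
theorem stmt14 [Fintype Ω] (p : Ω → ℝ) (hp : IsPMF p)
    (X Y : Finset (Finset Ω)) (hX : IsHyp X) (hY : IsHyp Y) :
    Hent p (himpHyp X Y ∩ himpHyp Y X) ≤
      (⨅ (M : Finset (Finset Ω)) (_ : IsOI M ∧ X ∩ M ⊆ Y ∧ Y ∩ M ⊆ X), Hent p M) ∧
    (⨅ (M : Finset (Finset Ω)) (_ : IsOI M ∧ X ∩ M ⊆ Y ∧ Y ∩ M ⊆ X), Hent p M) ≤
      Hent p (himpHyp X Y ∩ himpHyp Y X) +
        elog2 (Hent p (himpHyp X Y ∩ himpHyp Y X) + ENNReal.ofReal 3.4) + 1 ∧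
    (⨅ (M : Finset (Finset Ω)) (_ : IsOI M ∧ X ∩ M ⊆ Y ∧ Y ∩ M ⊆ X), Hent p M) ≤
      (⨅ (M : Finset (Finset Ω)) (_ : IsOI M ∧ X ∩ M ⊆ Y ∧ Y ∩ M ⊆ X), H0ent p M) ∧
    (⨅ (M : Finset (Finset Ω)) (_ : IsOI M ∧ X ∩ M ⊆ Y ∧ Y ∩ M ⊆ X), H0ent p M) =
      H0ent p (himpHyp X Y ∩ himpHyp Y X) := by
  refine ⟨le_iInf₂ fun M hM => Hent_mono p (feas_sub hM), ?_,
    iInf₂_mono fun M _ => Hent_le_H0 p hp M,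
    le_antisymm ?_ (le_iInf₂ fun M hM => H0_mono p (feas_sub hM))⟩
  · set N := himpHyp X Y ∩ himpHyp Y X with hN
    rcases eq_or_ne (Hent p N) ⊤ with htop | hfin
    · rw [htop]; simp
    set H : ℝ := (Hent p N).toReal with hH
    have hH0 : 0 ≤ H := ENNReal.toReal_nonneg
    have hHe : Hent p N = ENNReal.ofReal H := (ENNReal.ofReal_toReal hfin).symm
    have hlt : Hent p N < ENNReal.ofReal (H + 1 / (H + 2)) := by
      rw [hHe]
      refine (ENNReal.ofReal_lt_ofReal_iff (by positivity)).2 ?_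
      have : 0 < 1 / (H + 2) := by positivity
      linarith
    have hex : ∃ k, ValidK p N k ∧ MI p k < H + 1 / (H + 2) := by
      unfold Hent at hlt
      simp only [iInf_lt_iff] at hlt
      obtain ⟨k, hk, h⟩ := hlt
      exact ⟨k, hk, (ENNReal.ofReal_lt_ofReal_iff (by positivity)).1 h⟩
    obtain ⟨k, hk, hMI⟩ := hex
    obtain ⟨M, hM, hMN, hb⟩ := main_step p hp N star_down k hk (H + 1) (by positivity)
    refine (iInf₂_le M (feas_of_sub hM hMN)).trans (hb.trans ?_)
    have hl : 0 ≤ Real.logb 2 (H + 3.4) :=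
      Real.logb_nonneg (by norm_num) (by norm_num; linarith)
    have he : elog2 (Hent p N + ENNReal.ofReal 3.4) = ENNReal.ofReal (Real.logb 2 (H + 3.4)) := by
      rw [hHe, ← ENNReal.ofReal_add hH0 (by norm_num), elog2, if_neg ENNReal.ofReal_ne_top,
        ENNReal.toReal_ofReal (by positivity)]
    rw [he, hHe, ← ENNReal.ofReal_one, ← ENNReal.ofReal_add hH0 hl,
      ← ENNReal.ofReal_add (by positivity) (by norm_num)]
    apply ENNReal.ofReal_le_ofReal
    have h1 : Real.logb 2 (1 + (H + 1)) ≤ Real.logb 2 (H + 3.4) :=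
      Real.logb_le_logb_of_le (by norm_num) (by positivity) (by norm_num; linarith)
    have h2 := mul_le_mul_of_nonneg_left hMI.le (show 0 ≤ 1 + 1 / (H + 1) by positivity)
    have h3 : (1 + 1 / (H + 1)) * (H + 1 / (H + 2)) = H + 1 := by
      field_simp
      ring
    linarith
  · refine le_iInf₂ fun S hS => ?_
    obtain ⟨c, hc, hcz⟩ := cover_choice hp hS.2
    obtain ⟨z0, h0⟩ := exists_pos hp
    set U : Finset Ω := univ.filter fun z => z ∈ c z with hU
    have hOI : IsOI (mkOI U c S) := mkOI_isOI U c S ⟨c z0, hc z0⟩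
    have hsub : mkOI U c S ⊆ himpHyp X Y ∩ himpHyp Y X := by
      intro C hC
      simp only [mkOI, Finset.mem_filter, Finset.mem_univ, true_and] at hC
      obtain ⟨A, hA, hC⟩ := hC
      refine star_down A (hS.1 hA) C (hC.trans ?_)
      intro z hz
      obtain ⟨h1, rfl⟩ := Finset.mem_filter.1 hz
      exact (Finset.mem_filter.1 h1).2
    refine (iInf₂_le (mkOI U c S) (feas_of_sub hOI hsub)).trans ?_
    refine (iInf₂_le (S.image fun A => U.filter (fun z => c z = A)) ⟨?_, ?_⟩).trans ?_
    rotate_left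
    · intro C hC
      obtain ⟨A, hA, rfl⟩ := Finset.mem_image.1 hC
      simp only [mkOI, Finset.mem_filter, Finset.mem_univ, true_and]
      exact ⟨A, hA, subset_rfl⟩
    · intro z hz
      exact ⟨_, Finset.mem_image_of_mem _ (hc z), by simp [hU, hcz z hz]⟩
    · apply ENNReal.ofReal_le_ofReal
      apply Real.logb_le_logb_of_le (by norm_num)
      · exact_mod_cast Finset.card_pos.2 (Finset.Nonempty.image ⟨c z0, hc z0⟩ _)
      · exact_mod_cast Finset.card_image_le

end
end

section
/- Let X, Y, X', Y' be hyperconfusions over a finite probability space (Ω, p) with supp(p) = Ω. Then: (i) if X ⊇ X' and Y ⊆ Y', then H(X↘Y) ≤ H(X'↘Y'); (ii) H(X) = H(X↘{∅}) = H(X↘sing(Ω)), where sing(Ω) := {∅} ∪ {{ω} : ω ∈ Ω}; (iii) if X ∈ OIs(Ω) and Y ⊆ X, then H(X↘Y) = H(X). -/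
open Finset
open scoped Classical ENNReal

noncomputable section

variable {Ω : Type*}

section helpers15

variable [Fintype Ω]

theorem aux_mono (p : Ω → ℝ) (X Y X' Y' : Finset (Finset Ω)) (h1 : X' ⊆ X) (h2 : Y ⊆ Y') :
    Hcoarse p X Y ≤ Hcoarse p X' Y' := by
  unfold Hcoarse
  by_cases h : Y' ∪ singHyp Ω ⊆ X'
  · have hs : Y ∪ singHyp Ω ⊆ Y' ∪ singHyp Ω := Finset.union_subset_union_left h2
    rw [if_pos h, if_pos ((hs.trans h).trans h1)]
    refine iSup_le fun q => iSup_le fun hq => ?_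
    have hq' : ValidQ p (Y' ∪ singHyp Ω) q := by
      obtain ⟨a, b, c, d⟩ := hq
      refine ⟨a, fun B hB => hs (b B hB), c, fun S => (d S).trans ?_⟩
      refine Finset.sum_le_sum_of_subset_of_nonneg hs fun B _ _ => ?_
      split_ifs
      · exact a B
      · exact le_rfl
    refine le_trans ?_ (le_iSup₂ (f := fun (q : Finset Ω → ℝ)
      (_ : ValidQ p (Y' ∪ singHyp Ω) q) =>
      ⨅ (m : Finset Ω → Finset Ω → ℝ) (_ : ValidM X' q m), ENNReal.ofReal (MI2 q m)) q hq')
    refine le_iInf₂ fun m hm => ?_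
    obtain ⟨a, b, c, d⟩ := hm
    exact iInf₂_le m ⟨a, b, fun B A h => h1 (c B A h), d⟩
  · rw [if_neg h]; exact le_top

/-- The pushforward of `p` to singletons. -/
def qOf (p : Ω → ℝ) : Finset Ω → ℝ := fun B => ∑ z : Ω, if B = {z} then p z else 0

theorem qOf_single (p : Ω → ℝ) (z : Ω) : qOf p {z} = p z := by
  simp [qOf]

theorem sum_qOf (p : Ω → ℝ) (f : Finset Ω → ℝ) :
    ∑ B : Finset Ω, qOf p B * f B = ∑ z, p z * f {z} := by
  unfold qOf
  simp_rw [Finset.sum_mul]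
  rw [Finset.sum_comm]
  refine Finset.sum_congr rfl fun z _ => ?_
  simp [ite_mul]

theorem qOf_mem (p : Ω → ℝ) (B : Finset Ω) (h : qOf p B ≠ 0) : ∃ z, B = {z} := by
  by_contra hc
  push Not at hc
  exact h (Finset.sum_eq_zero fun z _ => by simp [hc z])

theorem mem_sing (B : Finset Ω) : B ∈ singHyp Ω ↔ B = ∅ ∨ ∃ z, B = {z} := by
  simp [singHyp, eq_comm]

theorem qOf_valid (p : Ω → ℝ) (hp : IsPMF p) : ValidQ p (singHyp Ω) (qOf p) := by
  have hnn : ∀ B, 0 ≤ qOf p B := fun B =>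
    Finset.sum_nonneg fun z _ => by split_ifs <;> simp [hp.1 z]
  have hm : ∀ B, qOf p B ≠ 0 → B ∈ singHyp Ω := fun B hB =>
    (mem_sing B).2 (Or.inr (qOf_mem p B hB))
  refine ⟨hnn, hm, ?_, fun S => ?_⟩
  · have := sum_qOf p (fun _ => 1)
    simpa [hp.2] using this
  · have h := sum_qOf p (fun B => if (S ∩ B).Nonempty then 1 else 0)
    have h2 : ∑ B ∈ singHyp Ω, (if (S ∩ B).Nonempty then qOf p B else 0)
        = ∑ B : Finset Ω, qOf p B * (if (S ∩ B).Nonempty then 1 else 0) := by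
      simp only [mul_ite, mul_one, mul_zero]
      refine Finset.sum_subset (Finset.subset_univ _) fun B _ hB => ?_
      have : qOf p B = 0 := by
        by_contra hc
        exact hB (hm B hc)
      simp [this]
    rw [h2, h, pset]
    apply le_of_eq
    rw [← Finset.sum_filter_add_sum_filter_not univ (fun z => z ∈ S)]
    simp only [mul_ite, mul_one, mul_zero]
    have e1 : ∀ z, (S ∩ {z}).Nonempty ↔ z ∈ S := by
      intro z
      simp [Finset.Nonempty]
    simp only [e1]
    rw [← Finset.sum_filter, ← Finset.sum_filter]
    simp [Finset.filter_filter]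

theorem validQ_sing_ge (p : Ω → ℝ) (q : Finset Ω → ℝ) (hq : ValidQ p (singHyp Ω) q) (z : Ω) :
    p z ≤ q {z} := by
  have h := hq.2.2.2 {z}
  refine (le_of_eq (by simp [pset])).trans (h.trans ?_)
  rw [Finset.sum_eq_single {z}]
  · simp
  · intro B hB hne
    rw [if_neg]
    rintro ⟨w, hw⟩
    rcases (mem_sing B).1 hB with rfl | ⟨v, rfl⟩
    · simp at hw
    · simp at hw
      obtain ⟨rfl, rfl⟩ := hw
      exact hne rfl
  · intro h'
    exact absurd ((mem_sing {z}).2 (Or.inr ⟨z, rfl⟩)) h'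

theorem validQ_sing_eq (p : Ω → ℝ) (hp : IsPMF p) (q : Finset Ω → ℝ)
    (hq : ValidQ p (singHyp Ω) q) : q = qOf p := by
  have hle : ∀ B ∈ (univ : Finset (Finset Ω)), qOf p B ≤ q B := by
    intro B _
    by_cases h : qOf p B = 0
    · rw [h]; exact hq.1 B
    · obtain ⟨z, rfl⟩ := qOf_mem p B h
      rw [qOf_single]
      exact validQ_sing_ge p q hq z
  have hs : ∑ B : Finset Ω, qOf p B = ∑ B : Finset Ω, q B := by
    rw [hq.2.2.1, (qOf_valid p hp).2.2.1]
  have := (Finset.sum_eq_sum_iff_of_le hle).1 hs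
  funext B
  exact (this B (Finset.mem_univ _)).symm

theorem MI2_qOf (p : Ω → ℝ) (m : Finset Ω → Finset Ω → ℝ) :
    MI2 (qOf p) m = MI p (fun z => m {z}) := by
  unfold MI2 MI
  have h1 : ∀ A, ∑ B : Finset Ω, qOf p B * m B A = ∑ z, p z * m {z} A := fun A =>
    sum_qOf p (fun B => m B A)
  simp_rw [h1, mul_assoc, ← Finset.mul_sum]
  exact sum_qOf p _

theorem Hent_top (p : Ω → ℝ) (hpos : ∀ ω : Ω, 0 < p ω) (X : Finset (Finset Ω)) (hX : IsHyp X)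
    (h : ¬ singHyp Ω ⊆ X) : Hent p X = ⊤ := by
  refine iInf₂_eq_top.2 fun k hk => ?_
  exfalso
  obtain ⟨a, b, c, d⟩ := hk
  apply h
  intro B hB
  obtain ⟨⟨C, hC⟩, hd⟩ := hX
  rcases (mem_sing B).1 hB with rfl | ⟨z, rfl⟩
  · exact hd C hC _ (Finset.empty_subset _)
  · have : ∃ A ∈ (univ : Finset (Finset Ω)), k z A ≠ 0 := by
      apply Finset.exists_ne_zero_of_sum_ne_zero
      rw [b z]; exact one_ne_zero
    obtain ⟨A, _, hA⟩ := this
    have hA' := lt_of_le_of_ne (a z A) (Ne.symm hA)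
    exact hd A (c z A hA') _ (by simpa using d z A (hpos z) hA')

theorem aux_sing (p : Ω → ℝ) (hp : IsPMF p) (hpos : ∀ ω : Ω, 0 < p ω)
    (X Y : Finset (Finset Ω)) (hX : IsHyp X) (hY : Y ⊆ singHyp Ω) :
    Hent p X = Hcoarse p X Y := by
  have hu : Y ∪ singHyp Ω = singHyp Ω := Finset.union_eq_right.2 hY
  unfold Hcoarse
  rw [hu]
  by_cases h : singHyp Ω ⊆ X
  · rw [if_pos h]
    have hM : (⨅ (m : Finset Ω → Finset Ω → ℝ) (_ : ValidM X (qOf p) m),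
        ENNReal.ofReal (MI2 (qOf p) m)) = Hent p X := by
      apply le_antisymm
      · refine le_iInf₂ fun k hk => ?_
        obtain ⟨a, b, c, d⟩ := hk
        let m : Finset Ω → Finset Ω → ℝ := fun B A =>
          if hB : ∃ z, B = {z} then k hB.choose A else if A = ∅ then 1 else 0
        have hm1 : ∀ z, m {z} = k z := by
          intro z
          funext A
          have hB : ∃ w, ({z} : Finset Ω) = {w} := ⟨z, rfl⟩
          have : hB.choose = z := (Finset.singleton_injective hB.choose_spec).symm
          simp only [m, dif_pos hB, this]
        have hm2 : ∀ B, (¬ ∃ z, B = {z}) → m B = fun A => if A = ∅ then 1 else 0 := by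
          intro B hB
          funext A
          simp only [m, dif_neg hB]
        have hv : ValidM X (qOf p) m := by
          refine ⟨fun B A => ?_, fun B => ?_, fun B A => ?_, fun B A => ?_⟩
          · by_cases hB : ∃ z, B = {z}
            · obtain ⟨z, rfl⟩ := hB
              rw [hm1]; exact a z A
            · rw [hm2 B hB]; dsimp only; split_ifs <;> norm_num
          · by_cases hB : ∃ z, B = {z}
            · obtain ⟨z, rfl⟩ := hB
              rw [hm1]; exact b z
            · rw [hm2 B hB]; simp
          · by_cases hB : ∃ z, B = {z}
            · obtain ⟨z, rfl⟩ := hB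
              rw [hm1]; exact c z A
            · rw [hm2 B hB]; dsimp only
              split_ifs with hA
              · intro _
                rw [hA]
                exact h ((mem_sing ∅).2 (Or.inl rfl))
              · intro h'; exact absurd h' (lt_irrefl _)
          · intro hq hmA
            obtain ⟨z, rfl⟩ := qOf_mem p B hq.ne'
            rw [hm1] at hmA
            simpa using d z A (hpos z) hmA
        refine (iInf₂_le m hv).trans (le_of_eq ?_)
        rw [MI2_qOf]
        simp_rw [hm1]
      · refine le_iInf₂ fun m hm => ?_
        obtain ⟨a, b, c, d⟩ := hm
        rw [MI2_qOf]
        refine iInf₂_le (fun z => m {z})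
          ⟨fun z A => a {z} A, fun z => b {z}, fun z A => c {z} A, fun z A hz hA => ?_⟩
        have := d {z} A (by rw [qOf_single]; exact hz) hA
        simpa using this
    apply le_antisymm
    · rw [← hM]
      exact le_iSup₂ (f := fun (q : Finset Ω → ℝ) (_ : ValidQ p (singHyp Ω) q) =>
        ⨅ (m : Finset Ω → Finset Ω → ℝ) (_ : ValidM X q m), ENNReal.ofReal (MI2 q m))
        (qOf p) (qOf_valid p hp)
    · refine iSup₂_le fun q hq => ?_
      rw [validQ_sing_eq p hp q hq, hM]
  · rw [if_neg h, Hent_top p hpos X hX h]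

/-- Probability of the fibre of the block map. -/
def fibP (p : Ω → ℝ) (b : Ω → Finset Ω) (T : Finset Ω) : ℝ := ∑ z, if b z = T then p z else 0

theorem fib_sum {ι : Type*} [Fintype ι] (p : ι → ℝ) (b : ι → Finset Ω) (f : Finset Ω → ℝ) :
    ∑ T : Finset Ω, (∑ z, if b z = T then p z else 0) * f T = ∑ z, p z * f (b z) := by
  simp_rw [Finset.sum_mul]
  rw [Finset.sum_comm]
  refine Finset.sum_congr rfl fun z _ => ?_
  simp [ite_mul]

/-- The entropy of any admissible kernel is at least the entropy of the block. -/
theorem MI_ge_s15 (p : Ω → ℝ) (hp : IsPMF p) (hpos : ∀ ω : Ω, 0 < p ω) (X : Finset (Finset Ω))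
    (b : Ω → Finset Ω) (β : Finset Ω → Finset Ω) (hβ : ∀ A ∈ X, ∀ z ∈ A, β A = b z)
    (k : Ω → Finset Ω → ℝ) (hk : ValidK p X k) :
    ∑ z, p z * Real.logb 2 (1 / fibP p b (b z)) ≤ MI p k := by
  obtain ⟨k0, k1, k2, k3⟩ := hk
  have hP0 : ∀ T, 0 ≤ fibP p b T := fun T =>
    Finset.sum_nonneg fun z _ => by split_ifs <;> simp [hp.1 z]
  have hP : ∀ z, 0 < fibP p b (b z) := by
    intro z
    refine lt_of_lt_of_le (hpos z) ?_
    have := Finset.single_le_sum (f := fun w => if b w = b z then p w else 0)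
      (fun w _ => by split_ifs <;> simp [hp.1 w]) (Finset.mem_univ z)
    simpa [fibP] using this
  set kb : Finset Ω → ℝ := fun A => ∑ z, p z * k z A with hkb
  have kb0 : ∀ A, 0 ≤ kb A := fun A =>
    Finset.sum_nonneg fun z _ => mul_nonneg (hp.1 z) (k0 z A)
  have kb1 : ∑ A, kb A = 1 := by
    rw [hkb, Finset.sum_comm]
    simp_rw [← Finset.mul_sum, k1, mul_one]
    exact hp.2
  have hl : 0 < Real.log 2 := Real.log_pos one_lt_two
  have key : ∀ z A, p z * k z A * Real.logb 2 (1 / fibP p b (b z)) +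
      (Real.log 2)⁻¹ * (p z * k z A -
        kb A * (if b z = β A then p z / fibP p b (b z) else 0)) ≤
      p z * k z A * Real.logb 2 (k z A / kb A) := by
    intro z A
    rcases (k0 z A).eq_or_lt with h | h
    · rw [← h]
      have : 0 ≤ kb A * (if b z = β A then p z / fibP p b (b z) else 0) := by
        apply mul_nonneg (kb0 A)
        split_ifs
        · exact div_nonneg (hp.1 z) (hP0 _)
        · exact le_rfl
      have h2 : 0 ≤ (Real.log 2)⁻¹ := by positivity
      have := mul_nonneg h2 this
      simp only [mul_zero, zero_mul]
      linarith
    · have hz := k3 z A (hpos z) h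
      rw [if_pos (hβ A (k2 z A h) z hz).symm]
      have hkA : 0 < kb A := by
        refine lt_of_lt_of_le (mul_pos (hpos z) h) ?_
        exact Finset.single_le_sum (f := fun w => p w * k w A)
          (fun w _ => mul_nonneg (hp.1 w) (k0 w A)) (Finset.mem_univ z)
      have hPz := hP z
      have hx : 0 < k z A * fibP p b (b z) / kb A := by positivity
      have hlog := Real.one_sub_inv_le_log_of_pos hx
      have e1 : Real.log (k z A * fibP p b (b z) / kb A) =
          Real.log (k z A / kb A) - Real.log (1 / fibP p b (b z)) := by
        rw [Real.log_div (by positivity) hkA.ne', Real.log_mul h.ne' hPz.ne',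
          Real.log_div h.ne' hkA.ne', one_div, Real.log_inv]
        ring
      rw [e1] at hlog
      have hpk : 0 ≤ (Real.log 2)⁻¹ * (p z * k z A) := by
        have := hpos z
        positivity
      have := mul_le_mul_of_nonneg_left hlog hpk
      have e2 : p z * k z A * (k z A * fibP p b (b z) / kb A)⁻¹ =
          kb A * (p z / fibP p b (b z)) := by
        field_simp
      rw [← e2]
      simp only [Real.logb, div_eq_mul_inv _ (Real.log 2)]
      linarith
  have hsum := Finset.sum_le_sum (s := univ) fun z (_ : z ∈ (univ : Finset Ω)) =>
    Finset.sum_le_sum (s := univ) fun A (_ : A ∈ (univ : Finset (Finset Ω))) => key z A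
  have hMI : MI p k = ∑ z, ∑ A, p z * k z A * Real.logb 2 (k z A / kb A) := rfl
  rw [hMI]
  refine le_trans ?_ hsum
  simp_rw [Finset.sum_add_distrib]
  have s1 : ∑ z, ∑ A, p z * k z A * Real.logb 2 (1 / fibP p b (b z)) =
      ∑ z, p z * Real.logb 2 (1 / fibP p b (b z)) := by
    refine Finset.sum_congr rfl fun z _ => ?_
    rw [← Finset.sum_mul, ← Finset.mul_sum, k1, mul_one]
  rw [s1]
  have s2 : 0 ≤ ∑ z, ∑ A, (Real.log 2)⁻¹ * (p z * k z A -
        kb A * (if b z = β A then p z / fibP p b (b z) else 0)) := by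
    simp_rw [← Finset.mul_sum, Finset.sum_sub_distrib]
    apply mul_nonneg (by positivity)
    have a1 : ∑ z, ∑ A, p z * k z A = 1 := by
      simp_rw [← Finset.mul_sum, k1, mul_one]
      exact hp.2
    rw [a1, Finset.sum_comm]
    simp_rw [← Finset.mul_sum]
    rw [sub_nonneg, ← kb1]
    refine Finset.sum_le_sum fun A _ => mul_le_of_le_one_right (kb0 A) ?_
    have a2 : ∑ z, (if b z = β A then p z / fibP p b (b z) else 0) =
        fibP p b (β A) / fibP p b (β A) := by
      conv_rhs => rw [fibP, Finset.sum_div]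
      refine Finset.sum_congr rfl fun z _ => ?_
      split_ifs with hz
      · rw [hz]; rfl
      · simp
    rw [a2]
    exact div_self_le_one _
  linarith

theorem aux_oi (p : Ω → ℝ) (hp : IsPMF p) (hpos : ∀ ω : Ω, 0 < p ω)
    (X Y : Finset (Finset Ω)) (hX : IsHyp X) (hoi : IsOI X) (hYX : Y ⊆ X) :
    Hcoarse p X Y ≤ Hent p X := by
  by_cases hs : singHyp Ω ⊆ X
  swap
  · rw [Hent_top p hpos X hX hs]; exact le_top
  obtain ⟨S, -, hdis, hS⟩ := hoi
  have hex : ∀ z : Ω, ∃ A ∈ S, z ∈ A := by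
    intro z
    have : ({z} : Finset Ω) ∈ X := hs ((mem_sing _).2 (Or.inr ⟨z, rfl⟩))
    obtain ⟨A, hA, h⟩ := (hS _).1 this
    exact ⟨A, hA, by simpa using h⟩
  choose b hbS hzb using hex
  have huniq : ∀ A ∈ S, ∀ z ∈ A, A = b z := by
    intro A hA z hz
    by_contra hne
    exact Finset.disjoint_left.1 (hdis A hA (b z) (hbS z) hne) hz (hzb z)
  let β : Finset Ω → Finset Ω := fun B => if h : B.Nonempty then b h.choose else ∅
  have hβ : ∀ A ∈ X, ∀ z ∈ A, β A = b z := by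
    intro A hA z hz
    have hne : A.Nonempty := ⟨z, hz⟩
    obtain ⟨C, hC, hAC⟩ := (hS A).1 hA
    simp only [β, dif_pos hne]
    rw [← huniq C hC z (hAC hz), ← huniq C hC _ (hAC hne.choose_spec)]
  have hβX : ∀ B, β B ∈ X := by
    intro B
    by_cases hB : B.Nonempty
    · simp only [β, dif_pos hB]
      exact (hS _).2 ⟨_, hbS _, subset_rfl⟩
    · simp only [β, dif_neg hB]
      exact hs ((mem_sing _).2 (Or.inl rfl))
  have hsub : ∀ B ∈ X, B ⊆ β B := by
    intro B hB z hz
    rw [hβ B hB z hz]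
    exact hzb z
  have hYt : Y ∪ singHyp Ω ⊆ X := Finset.union_subset hYX hs
  refine le_iInf₂ fun k hk => ?_
  unfold Hcoarse
  rw [if_pos hYt]
  refine iSup₂_le fun q hq => ?_
  obtain ⟨q0, q1, q2, q3⟩ := hq
  let m : Finset Ω → Finset Ω → ℝ := fun B A => if β B = A then 1 else 0
  have hm : ValidM X q m := by
    refine ⟨fun B A => ?_, fun B => ?_, fun B A h => ?_, fun B A hq h => ?_⟩
    · simp only [m]; split_ifs <;> norm_num
    · simp [m]
    · have : β B = A := by
        by_contra hc
        simp [m, hc] at h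
      rw [← this]; exact hβX B
    · have : β B = A := by
        by_contra hc
        simp [m, hc] at h
      rw [← this]; exact hsub B (hYt (q1 B hq.ne'))
  refine (iInf₂_le m hm).trans (ENNReal.ofReal_le_ofReal ?_)
  refine le_trans (le_of_eq ?_) (MI_ge_s15 p hp hpos X b β hβ k hk)
  have hPQ : ∀ T, fibP p b T ≤ ∑ B, if β B = T then q B else 0 := by
    intro T
    have h := q3 (univ.filter fun z => b z = T)
    have e : pset p (univ.filter fun z => b z = T) = fibP p b T := by
      rw [pset, fibP, Finset.sum_filter]
    rw [e] at h
    refine h.trans ?_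
    refine le_trans (Finset.sum_le_sum (g := fun B => if β B = T then q B else 0) ?_)
      (Finset.sum_le_sum_of_subset_of_nonneg (Finset.subset_univ _) ?_)
    · intro B hB
      by_cases hn : ((univ.filter fun z => b z = T) ∩ B).Nonempty
      · obtain ⟨z, hz⟩ := hn
        simp only [Finset.mem_inter, Finset.mem_filter, Finset.mem_univ, true_and] at hz
        have : β B = T := (hβ B (hYt hB) z hz.2).trans hz.1
        rw [if_pos this]
        split_ifs
        · exact le_rfl
        · exact q0 B
      · rw [if_neg hn]
        split_ifs
        · exact q0 B
        · exact le_rfl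
    · intro B _ _
      split_ifs
      · exact q0 B
      · exact le_rfl
  have hPQe : ∀ T, (∑ B, if β B = T then q B else 0) = fibP p b T := by
    have hsum : ∑ T, fibP p b T = ∑ T, ∑ B, if β B = T then q B else 0 := by
      have h1 := fib_sum p b (fun _ => 1)
      have h2 := fib_sum q β (fun _ => 1)
      simp only [mul_one] at h1 h2
      rw [h2, q2, ← hp.2, ← h1]
      rfl
    intro T
    exact ((Finset.sum_eq_sum_iff_of_le fun T _ => hPQ T).1 hsum T (Finset.mem_univ T)).symm
  have e1 : MI2 q m = ∑ B, q B * Real.logb 2 (1 / fibP p b (β B)) := by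
    unfold MI2
    refine Finset.sum_congr rfl fun B _ => ?_
    rw [Finset.sum_eq_single (β B)]
    · have : ∑ B', q B' * m B' (β B) = fibP p b (β B) := by
        rw [← hPQe]
        simp [m]
      rw [this]
      simp [m]
    · intro A _ hA
      simp [m, Ne.symm hA]
    · simp
  rw [e1, ← fib_sum q β (fun T => Real.logb 2 (1 / fibP p b T))]
  simp_rw [hPQe]
  exact fib_sum p b (fun T => Real.logb 2 (1 / fibP p b T))

end helpers15

/-- Properties of the coarse entropy `H(X ↘ Y)` when `supp(p) = Ω`:
(i) it is antitone in `X` and monotone in `Y`; (ii) `H(X) = H(X ↘ {∅}) = H(X ↘ sing(Ω))`;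
(iii) if `X` is an ordinary information and `Y ⊆ X`, then `H(X ↘ Y) = H(X)`. -/
theorem stmt15 [Fintype Ω] (p : Ω → ℝ) (hp : IsPMF p) (hpos : ∀ ω : Ω, 0 < p ω)
    (X Y X' Y' : Finset (Finset Ω))
    (hX : IsHyp X) (hY : IsHyp Y) (hX' : IsHyp X') (hY' : IsHyp Y') :
    ((X' ⊆ X ∧ Y ⊆ Y') → Hcoarse p X Y ≤ Hcoarse p X' Y') ∧
    Hent p X = Hcoarse p X ({(∅ : Finset Ω)} : Finset (Finset Ω)) ∧
    Hent p X = Hcoarse p X (singHyp Ω) ∧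
    (IsOI X → Y ⊆ X → Hcoarse p X Y = Hent p X) := by
  have hempty : ∀ Z : Finset (Finset Ω), IsHyp Z → ({∅} : Finset (Finset Ω)) ⊆ Z := by
    rintro Z ⟨⟨C, hC⟩, hd⟩ B hB
    rw [Finset.mem_singleton.1 hB]
    exact hd C hC _ (Finset.empty_subset _)
  have hsing : ({∅} : Finset (Finset Ω)) ⊆ singHyp Ω := by
    intro B hB
    exact (mem_sing B).2 (Or.inl (Finset.mem_singleton.1 hB))
  refine ⟨fun h => aux_mono p X Y X' Y' h.1 h.2, aux_sing p hp hpos X _ hX hsing,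
    aux_sing p hp hpos X _ hX subset_rfl, fun hoi hYX => le_antisymm
      (aux_oi p hp hpos X Y hX hoi hYX) ?_⟩
  rw [aux_sing p hp hpos X _ hX hsing]
  exact aux_mono p X _ X Y subset_rfl (hempty Y hY)

end
end

section
/- (Unconfusing lemma for coarse entropy) Let X, Y be hyperconfusions over a finite probability space (Ω, p) with supp(p) = Ω, where Y ∈ OIs(Ω) and Y ⊆ X. Then there exists X̂ ∈ OIs(Ω) with Y ⊆ X̂ ⊆ X and H(X̂) ≤ H(X↘Y) + log₂(H(X↘Y) + 3.4) + 1. -/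
open Finset
open scoped Classical ENNReal

noncomputable section

variable {Ω : Type*}

/-- Greedy covering: a labelling `K` with small weighted sum. -/
lemma greedy_cover {ι α : Type*} [Fintype α] (q : ι → ℝ) (R : ι → α → Prop) (r : α → ℝ)
    (hr0 : ∀ a, 0 ≤ r a) (hr1 : ∑ a, r a = 1) (d : α) :
    ∀ (n : ℕ) (U : Finset ι), U.card = n →
      (∀ i ∈ U, 0 < q i * ∑ a, if R i a then r a else 0) →
      ∃ (K : ι → ℕ) (F : ℕ → α), (∀ i ∈ U, 1 ≤ K i ∧ R i (F (K i))) ∧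
        ∑ i ∈ U, (q i * ∑ a, if R i a then r a else 0) * (K i : ℝ) ≤ ∑ i ∈ U, q i := by
  intro n
  induction n using Nat.strong_induction_on with
  | _ n ih =>
  intro U hU hc
  set c : ι → ℝ := fun i => q i * ∑ a, if R i a then r a else 0 with hcdef
  by_cases hne : U.Nonempty
  swap
  · rw [Finset.not_nonempty_iff_eq_empty] at hne
    subst hne
    exact ⟨fun _ => 1, fun _ => d, by simp, by simp⟩
  have hcU : 0 < ∑ i ∈ U, c i := Finset.sum_pos hc hne
  have hex : ∃ a, ∑ i ∈ U, c i ≤ ∑ i ∈ U with R i a, q i := by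
    by_contra hcon
    push Not at hcon
    have h1 : ∑ a, r a * ∑ i ∈ U with R i a, q i = ∑ i ∈ U, c i := by
      simp only [hcdef, Finset.sum_filter, Finset.mul_sum]
      rw [Finset.sum_comm]
      refine Finset.sum_congr rfl fun i _ => Finset.sum_congr rfl fun a _ => ?_
      split_ifs <;> ring
    have h2 : ∑ a, r a * ∑ i ∈ U with R i a, q i < ∑ a, r a * ∑ i ∈ U, c i := by
      have : ∃ a, 0 < r a := by
        by_contra h
        push Not at h
        have : ∑ a, r a ≤ 0 := Finset.sum_nonpos fun a _ => h a
        linarith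
      obtain ⟨a, ha⟩ := this
      refine Finset.sum_lt_sum (fun b _ => mul_le_mul_of_nonneg_left (hcon b).le (hr0 b))
        ⟨a, Finset.mem_univ a, mul_lt_mul_of_pos_left (hcon a) ha⟩
    rw [← Finset.sum_mul, hr1, one_mul, h1] at h2
    exact lt_irrefl _ h2
  obtain ⟨a, ha⟩ := hex
  have hlt : (U.filter fun i => ¬ R i a).card < n := by
    rw [← hU]
    apply Finset.card_lt_card
    refine Finset.filter_ssubset.2 ?_
    by_contra hno
    push Not at hno
    have : U.filter (fun i => R i a) = ∅ := Finset.filter_eq_empty_iff.2 hno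
    rw [this] at ha
    simp at ha
    linarith
  obtain ⟨K, F, hKF, hsum⟩ := ih _ hlt (U.filter fun i => ¬ R i a) rfl
    (fun i hi => hc i (Finset.mem_filter.1 hi).1)
  refine ⟨fun i => if R i a then 1 else K i + 1, fun k => if k ≤ 1 then a else F (k - 1), ?_, ?_⟩
  · intro i hi
    by_cases h : R i a
    · simp [h]
    · have := hKF i (Finset.mem_filter.2 ⟨hi, h⟩)
      simp only [h, if_false]
      refine ⟨by omega, ?_⟩
      rw [if_neg (by omega)]
      simpa using this.2
  · have e1 := Finset.sum_filter_add_sum_filter_not U (fun i => R i a)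
      (fun i => c i * ((if R i a then 1 else K i + 1 : ℕ) : ℝ))
    have e2 := Finset.sum_filter_add_sum_filter_not U (fun i => R i a) c
    have e3 := Finset.sum_filter_add_sum_filter_not U (fun i => R i a) q
    have e4 : ∑ i ∈ U with R i a, c i * ((if R i a then 1 else K i + 1 : ℕ) : ℝ)
        = ∑ i ∈ U with R i a, c i := by
      refine Finset.sum_congr rfl fun i hi => ?_
      simp [(Finset.mem_filter.1 hi).2]
    have e5 : ∑ i ∈ U with ¬ R i a, c i * ((if R i a then 1 else K i + 1 : ℕ) : ℝ)
        = ∑ i ∈ U with ¬ R i a, c i * (K i : ℝ) + ∑ i ∈ U with ¬ R i a, c i := by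
      rw [← Finset.sum_add_distrib]
      refine Finset.sum_congr rfl fun i hi => ?_
      simp only [(Finset.mem_filter.1 hi).2, if_false]
      push_cast
      ring
    rw [← e1, e4, e5]
    change ∑ i ∈ U with ¬ R i a, c i * (K i : ℝ) ≤ _ at hsum
    linarith

/-- Divergence bound: `-log r(supp m) ≤ D(m ‖ r)`. -/
lemma div_bound {α : Type*} [Fintype α] (m r : α → ℝ) (R : α → Prop)
    (hm0 : ∀ a, 0 ≤ m a) (hm1 : ∑ a, m a = 1) (hr0 : ∀ a, 0 ≤ r a)
    (hR : ∀ a, 0 < m a → R a) (hmr : ∀ a, 0 < m a → 0 < r a) :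
    0 < (∑ a, if R a then r a else 0) ∧
    - Real.log (∑ a, if R a then r a else 0) ≤ ∑ a, m a * Real.log (m a / r a) := by
  set s := ∑ a, if R a then r a else 0 with hs
  have hspos : 0 < s := by
    have : ∃ a, 0 < m a := by
      by_contra h
      push Not at h
      have : ∑ a, m a ≤ 0 := Finset.sum_nonpos fun a _ => h a
      linarith
    obtain ⟨a, ha⟩ := this
    refine Finset.sum_pos' (fun b _ => ?_) ⟨a, Finset.mem_univ a, ?_⟩
    · split_ifs
      exacts [hr0 b, le_rfl]
    · rw [if_pos (hR a ha)]
      exact hmr a ha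
  refine ⟨hspos, ?_⟩
  have key : ∀ a, m a - (if R a then r a else 0) / s
      ≤ m a * Real.log (m a / r a) + m a * Real.log s := by
    intro a
    rcases (hm0 a).eq_or_lt with h | h
    · rw [← h]
      have : 0 ≤ (if R a then r a else 0) / s := by
        apply div_nonneg _ hspos.le
        split_ifs
        exacts [hr0 a, le_rfl]
      simp only [zero_mul, add_zero]
      linarith
    · rw [if_pos (hR a h)]
      have hra := hmr a h
      have h1 := Real.log_le_sub_one_of_pos (x := r a / (m a * s)) (by positivity)
      rw [Real.log_div hra.ne' (by positivity), Real.log_mul h.ne' hspos.ne'] at h1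
      rw [Real.log_div h.ne' hra.ne']
      have h2 := mul_le_mul_of_nonneg_left h1 h.le
      have h3 : m a * (r a / (m a * s) - 1) = r a / s - m a := by
        field_simp
      rw [h3] at h2
      linarith
  have h := Finset.sum_le_sum fun a (_ : a ∈ Finset.univ) => key a
  rw [Finset.sum_sub_distrib, Finset.sum_add_distrib, ← Finset.sum_div, ← Finset.sum_mul, hm1,
    ← hs, div_self hspos.ne'] at h
  linarith

/-- Partial sums of the zeta series. -/
lemma zeta_bound (a : ℝ) (ha : 0 < a) (n : ℕ) :
    ∑ k ∈ Finset.Icc 1 (n + 1), (k : ℝ) ^ (-(1 + a))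
      ≤ 1 + 1 / a - ((n + 1 : ℕ) : ℝ) ^ (-a) / a := by
  induction n with
  | zero => simp
  | succ n ih =>
    rw [Finset.sum_Icc_succ_top (by omega)]
    set x : ℝ := ((n + 1 : ℕ) : ℝ) with hx
    have hx0 : 0 < x := by rw [hx]; positivity
    have hx1 : ((n + 1 + 1 : ℕ) : ℝ) = x + 1 := by rw [hx]; push_cast; ring
    rw [hx1]
    have hy : 0 < x + 1 := by linarith
    have key : (x + 1) ^ (-(1 + a)) ≤ x ^ (-a) / a - (x + 1) ^ (-a) / a := by
      have h1 : (x + 1) ^ (-(1 + a)) = (x + 1) ^ (-a) * (1 / (x + 1)) := by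
        rw [show -(1 + a) = -a + (-1) by ring, Real.rpow_add hy, Real.rpow_neg_one, one_div]
      have h2 : (x + 1) ^ (-a) * (1 + a / (x + 1)) ≤ x ^ (-a) := by
        rw [Real.rpow_def_of_pos hy, Real.rpow_def_of_pos hx0]
        have h3 : Real.log x ≤ Real.log (x + 1) - 1 / (x + 1) := by
          have := Real.log_le_sub_one_of_pos (x := x / (x + 1)) (by positivity)
          rw [Real.log_div hx0.ne' hy.ne'] at this
          have h4 : x / (x + 1) - 1 = - (1 / (x + 1)) := by field_simp; ring
          linarith
        have h5 : 1 + a / (x + 1) ≤ Real.exp (a / (x + 1)) := by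
          have := Real.add_one_le_exp (a / (x + 1))
          linarith
        calc _ ≤ Real.exp (Real.log (x + 1) * -a) * Real.exp (a / (x + 1)) := by gcongr
          _ = Real.exp (Real.log (x + 1) * -a + a / (x + 1)) := by rw [Real.exp_add]
          _ ≤ _ := by
            apply Real.exp_le_exp.2
            have := mul_le_mul_of_nonneg_left h3 ha.le
            have e : a * (Real.log (x + 1) - 1 / (x + 1))
              = a * Real.log (x + 1) - a / (x + 1) := by ring
            rw [e] at this
            linarith
      rw [h1, ← sub_div, le_div_iff₀ ha]
      have : (x + 1) ^ (-a) * (1 / (x + 1)) * a = (x + 1) ^ (-a) * (1 + a / (x + 1))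
        - (x + 1) ^ (-a) := by ring
      rw [this]
      linarith
    linarith

/-- Gibbs-type bound for the entropy of a positive-integer label. -/
lemma label_entropy {Ω : Type*} [Fintype Ω] (p : Ω → ℝ) (hp1 : ∑ z, p z = 1)
    (hpos : ∀ z, 0 < p z) (g : Ω → ℕ) (hg : ∀ z, 1 ≤ g z) (h : ℝ) (hh : 0 ≤ h)
    (hL : ∑ z, p z * Real.logb 2 (g z) ≤ h) :
    ∑ z, p z * Real.logb 2 (1 / ∑ z' with g z' = g z, p z') ≤ h + 1 + Real.logb 2 (h + 2) := by
  set P : ℕ → ℝ := fun k => ∑ z' with g z' = k, p z' with hP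
  set a : ℝ := 1 / (h + 1) with ha
  have ha0 : 0 < a := by positivity
  have hl2 : 0 < Real.log 2 := Real.log_pos (by norm_num)
  set w : ℕ → ℝ := fun k => (k : ℝ) ^ (-(1 + a)) / (h + 2) with hw
  have hPpos : ∀ z, 0 < P (g z) := fun z =>
    Finset.sum_pos (fun i _ => hpos i) ⟨z, by simp⟩
  have hgpos : ∀ z, (0 : ℝ) < g z := fun z => by
    have := hg z
    positivity
  have hwpos : ∀ z, 0 < w (g z) := fun z => by
    have := hgpos z
    simp only [hw]
    positivity
  have hwsum : ∑ k ∈ Finset.univ.image g, w k ≤ 1 := by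
    set N := ∑ z, g z with hN
    have hsub : Finset.univ.image g ⊆ Finset.Icc 1 (N + 1) := by
      intro k hk
      obtain ⟨z, _, rfl⟩ := Finset.mem_image.1 hk
      have : g z ≤ N := Finset.single_le_sum (f := g) (fun _ _ => Nat.zero_le _) (Finset.mem_univ z)
      simp [hg z]
      omega
    calc _ ≤ ∑ k ∈ Finset.Icc 1 (N + 1), w k :=
          Finset.sum_le_sum_of_subset_of_nonneg hsub (fun k _ _ => by simp only [hw]; positivity)
      _ = (∑ k ∈ Finset.Icc 1 (N + 1), (k : ℝ) ^ (-(1 + a))) / (h + 2) := by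
          simp only [hw, Finset.sum_div]
      _ ≤ 1 := by
          rw [div_le_one (by linarith)]
          have := zeta_bound a ha0 N
          have h1 : 1 / a = h + 1 := by simp [ha]
          have h2 : 0 ≤ ((N + 1 : ℕ) : ℝ) ^ (-a) / a := by positivity
          linarith
  have hgibbs : ∑ z, p z * Real.log (w (g z) / P (g z)) ≤ 0 := by
    have h1 : ∀ z, p z * Real.log (w (g z) / P (g z)) ≤ p z * (w (g z) / P (g z)) - p z := by
      intro z
      have := Real.log_le_sub_one_of_pos (div_pos (hwpos z) (hPpos z))
      have := mul_le_mul_of_nonneg_left this (hpos z).le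
      linarith
    have h2 : ∑ z, p z * (w (g z) / P (g z)) = ∑ k ∈ Finset.univ.image g, w k := by
      rw [← Finset.sum_fiberwise_of_maps_to
        (fun z (_ : z ∈ Finset.univ) => Finset.mem_image_of_mem g (Finset.mem_univ z))]
      refine Finset.sum_congr rfl fun k hk => ?_
      obtain ⟨z, _, rfl⟩ := Finset.mem_image.1 hk
      have : ∑ i with g i = g z, p i * (w (g i) / P (g i))
          = ∑ i with g i = g z, p i * (w (g z) / P (g z)) :=
        Finset.sum_congr rfl fun i hi => by rw [(Finset.mem_filter.1 hi).2]
      rw [this, ← Finset.sum_mul]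
      change P (g z) * _ = _
      have := (hPpos z).ne'
      field_simp
    have := Finset.sum_le_sum fun z (_ : z ∈ Finset.univ) => h1 z
    rw [Finset.sum_sub_distrib, h2, hp1] at this
    linarith
  have hterm : ∀ z, p z * Real.logb 2 (1 / P (g z))
      = p z * Real.log (w (g z) / P (g z)) / Real.log 2 + (1 + a) * (p z * Real.logb 2 (g z))
        + p z * Real.logb 2 (h + 2) := by
    intro z
    have e1 : Real.log (w (g z)) = -(1 + a) * Real.log (g z) - Real.log (h + 2) := by
      simp only [hw]
      rw [Real.log_div (Real.rpow_pos_of_pos (hgpos z) _).ne' (by positivity),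
        Real.log_rpow (hgpos z)]
    rw [Real.log_div (hwpos z).ne' (hPpos z).ne', e1, one_div]
    simp only [Real.logb, Real.log_inv]
    field_simp
    ring
  change ∑ z, p z * Real.logb 2 (1 / P (g z)) ≤ _
  rw [Finset.sum_congr rfl fun z _ => hterm z, Finset.sum_add_distrib, Finset.sum_add_distrib,
    ← Finset.sum_div, ← Finset.mul_sum, ← Finset.sum_mul, hp1]
  have h1 : (∑ z, p z * Real.log (w (g z) / P (g z))) / Real.log 2 ≤ 0 :=
    div_nonpos_of_nonpos_of_nonneg hgibbs hl2.le
  have h2 : (1 + a) * ∑ z, p z * Real.logb 2 (g z) ≤ (1 + a) * h :=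
    mul_le_mul_of_nonneg_left hL (by linarith)
  have h3 : a * h ≤ 1 := by
    rw [ha, div_mul_eq_mul_div, div_le_one (by linarith)]
    linarith
  linarith

/-- A valid `m` yields a labelling with small expected log. -/
lemma label_of_kernel [Fintype Ω] (X : Finset (Finset Ω)) (q : Finset Ω → ℝ)
    (hq0 : ∀ B, 0 ≤ q B) (hq1 : ∑ B, q B = 1) (m : Finset Ω → Finset Ω → ℝ)
    (hm : ValidM X q m) :
    ∃ (K : Finset Ω → ℕ) (F : ℕ → Finset Ω),
      (∀ B, 0 < q B → 1 ≤ K B ∧ B ⊆ F (K B) ∧ F (K B) ∈ X) ∧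
      ∑ B, q B * Real.logb 2 (K B) ≤ MI2 q m := by
  obtain ⟨hm0, hm1, hmX, hmS⟩ := hm
  have hl2 : 0 < Real.log 2 := Real.log_pos (by norm_num)
  set r : Finset Ω → ℝ := fun A => ∑ B, q B * m B A with hr
  have hr0 : ∀ A, 0 ≤ r A := fun A => Finset.sum_nonneg fun B _ => mul_nonneg (hq0 B) (hm0 B A)
  have hr1 : ∑ A, r A = 1 := by
    simp only [hr]
    rw [Finset.sum_comm]
    simp only [← Finset.mul_sum, hm1, mul_one, hq1]
  obtain ⟨R, hR⟩ : ∃ R : Finset Ω → Finset Ω → Prop, ∀ B A, R B A ↔ (B ⊆ A ∧ A ∈ X) :=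
    ⟨fun B A => B ⊆ A ∧ A ∈ X, fun _ _ => Iff.rfl⟩
  have hdiv : ∀ B, 0 < q B → 0 < (∑ A, if R B A then r A else 0) ∧
      - Real.log (∑ A, if R B A then r A else 0) ≤ ∑ A, m B A * Real.log (m B A / r A) := by
    intro B hB
    refine div_bound (m B) r (R B) (hm0 B) (hm1 B) hr0
      (fun A hA => (hR B A).2 ⟨hmS B A hB hA, hmX B A hA⟩) (fun A hA => ?_)
    exact lt_of_lt_of_le (mul_pos hB hA)
      (Finset.single_le_sum (f := fun B => q B * m B A)
        (fun B _ => mul_nonneg (hq0 B) (hm0 B A)) (Finset.mem_univ B))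
  obtain ⟨K, F, hKF, hsum⟩ := greedy_cover q R r hr0 hr1 ∅ _
    (Finset.univ.filter fun B => 0 < q B) rfl
    (fun B hB => mul_pos (Finset.mem_filter.1 hB).2 (hdiv B (Finset.mem_filter.1 hB).2).1)
  refine ⟨K, F, fun B hB => ?_, ?_⟩
  · have := hKF B (by simp [hB])
    exact ⟨this.1, (hR _ _).1 this.2⟩
  have hrest : ∀ f : Finset Ω → ℝ, ∑ B, q B * f B = ∑ B with 0 < q B, q B * f B := by
    intro f
    rw [Finset.sum_filter]
    refine Finset.sum_congr rfl fun B _ => ?_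
    split_ifs with h
    · rfl
    · rw [le_antisymm (not_lt.1 h) (hq0 B), zero_mul]
  have hMI : MI2 q m = ∑ B, q B * ((∑ A, m B A * Real.log (m B A / r A)) / Real.log 2) := by
    unfold MI2
    refine Finset.sum_congr rfl fun B _ => ?_
    rw [Finset.sum_div, Finset.mul_sum]
    refine Finset.sum_congr rfl fun A _ => ?_
    simp only [Real.logb, hr]
    ring
  rw [hMI, hrest, hrest]
  have hterm : ∀ B ∈ Finset.univ.filter (fun B => 0 < q B), q B * Real.logb 2 (K B) ≤
      q B * ((∑ A, m B A * Real.log (m B A / r A)) / Real.log 2)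
      + ((q B * ∑ A, if R B A then r A else 0) * (K B : ℝ) - q B) / Real.log 2 := by
    intro B hB
    have hqB := (Finset.mem_filter.1 hB).2
    obtain ⟨hs, hd⟩ := hdiv B hqB
    have hK1 := (hKF B hB).1
    have hK : (0 : ℝ) < K B := by positivity
    set s := ∑ A, if R B A then r A else 0
    have h1 := Real.log_le_sub_one_of_pos (mul_pos hs hK)
    rw [Real.log_mul hs.ne' hK.ne'] at h1
    have h2 : Real.log (K B) ≤ (∑ A, m B A * Real.log (m B A / r A)) + (s * K B - 1) := by
      linarith
    have h3 := mul_le_mul_of_nonneg_left (div_le_div_of_nonneg_right h2 hl2.le) hqB.le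
    refine h3.trans (le_of_eq ?_)
    ring
  refine (Finset.sum_le_sum hterm).trans ?_
  rw [Finset.sum_add_distrib, ← Finset.sum_div, Finset.sum_sub_distrib]
  have : (∑ B with 0 < q B, (q B * ∑ A, if R B A then r A else 0) * (K B : ℝ)
      - ∑ B with 0 < q B, q B) / Real.log 2 ≤ 0 :=
    div_nonpos_of_nonpos_of_nonneg (by linarith) hl2.le
  linarith

/-- Core bound for a finite value of the kernel mutual information. -/
lemma core_bound [Fintype Ω] (p : Ω → ℝ) (hp : IsPMF p) (hpos : ∀ ω : Ω, 0 < p ω)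
    (X Y : Finset (Finset Ω)) (hX : IsHyp X) (blk : Ω → Finset Ω) (hblk : ∀ z, z ∈ blk z)
    (hYb : ∀ C ∈ Y, C.Nonempty → ∃ z, C ⊆ blk z ∧ ∀ z' ∈ blk z, blk z' = blk z)
    (q : Finset Ω → ℝ) (hq : ∀ B, q B = ∑ z with blk z = B, p z)
    (m : Finset Ω → Finset Ω → ℝ) (hm : ValidM X q m) (h : ℝ) (hh : 0 ≤ h) (hmh : MI2 q m ≤ h) :
    ∃ Xh : Finset (Finset Ω), IsOI Xh ∧ Y ⊆ Xh ∧ Xh ⊆ X ∧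
      Hent p Xh ≤ ENNReal.ofReal (h + 1 + Real.logb 2 (h + 2)) := by
  have hq0 : ∀ B, 0 ≤ q B := fun B => by
    rw [hq]
    exact Finset.sum_nonneg fun z _ => (hpos z).le
  have hfib : ∀ f : Finset Ω → ℝ, ∑ B, q B * f B = ∑ z, p z * f (blk z) := by
    intro f
    rw [← Finset.sum_fiberwise Finset.univ blk]
    refine Finset.sum_congr rfl fun B _ => ?_
    rw [hq, Finset.sum_mul]
    exact Finset.sum_congr rfl fun z hz => by rw [(Finset.mem_filter.1 hz).2]
  have hq1 : ∑ B, q B = 1 := by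
    have := hfib fun _ => 1
    simpa [hp.2] using this
  have hqblk : ∀ z, 0 < q (blk z) := fun z => by
    rw [hq]
    exact Finset.sum_pos (fun i _ => hpos i) ⟨z, by simp⟩
  obtain ⟨K, F, hKF, hK⟩ := label_of_kernel X q hq0 hq1 m hm
  set g : Ω → ℕ := fun z => K (blk z) with hg
  set f : Ω → Finset Ω := fun z => Finset.univ.filter fun z' => g z' = g z with hf
  have hzf : ∀ z, z ∈ f z := fun z => by simp [hf]
  have hff : ∀ z z', f z' = f z ↔ g z' = g z := by
    intro z z'
    constructor
    · intro e
      have := hzf z'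
      rw [e] at this
      simpa [hf] using this
    · intro e
      simp [hf, e]
  have hne : Nonempty Ω := by
    by_contra hno
    rw [not_nonempty_iff] at hno
    have := hp.2
    simp at this
  have hfX : ∀ z, f z ∈ X := by
    intro z
    have h1 := (hKF (blk z) (hqblk z)).2.2
    refine hX.2 _ h1 _ fun z' hz' => ?_
    have e : g z' = g z := by simpa [hf] using hz'
    have h2 := (hKF (blk z') (hqblk z')).2.1 (hblk z')
    change z' ∈ F (g z') at h2
    rw [e] at h2
    exact h2
  have hmem : ∀ C : Finset Ω, C ∈ Finset.univ.filter (fun C : Finset Ω => ∃ z, C ⊆ f z) ↔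
      ∃ z, C ⊆ f z := by simp
  refine ⟨Finset.univ.filter fun C : Finset Ω => ∃ z, C ⊆ f z, ?_, ?_, ?_, ?_⟩
  · refine ⟨Finset.univ.image f, ?_, ?_, ?_⟩
    · exact Finset.univ_nonempty.image f
    · intro A hA B hB hAB
      obtain ⟨z, _, rfl⟩ := Finset.mem_image.1 hA
      obtain ⟨z', _, rfl⟩ := Finset.mem_image.1 hB
      rw [Finset.disjoint_left]
      intro y hy hy'
      apply hAB
      rw [hff]
      simp only [hf, Finset.mem_filter, Finset.mem_univ, true_and] at hy hy'
      rw [← hy, ← hy']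
    · intro C
      simp
  · intro C hC
    rw [hmem]
    rcases C.eq_empty_or_nonempty with rfl | hCne
    · exact ⟨hne.some, by simp⟩
    · obtain ⟨z, hz, hz'⟩ := hYb C hC hCne
      refine ⟨z, hz.trans fun y hy => ?_⟩
      simp [hf, hg, hz' y hy]
  · intro C hC
    rw [hmem] at hC
    obtain ⟨z, hz⟩ := hC
    exact hX.2 _ (hfX z) _ hz
  · set k : Ω → Finset Ω → ℝ := fun z A => if A = f z then 1 else 0 with hk
    have hkv : ValidK p (Finset.univ.filter fun C : Finset Ω => ∃ z, C ⊆ f z) k := by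
      refine ⟨fun z A => by simp only [hk]; split_ifs <;> norm_num, fun z => by simp [hk], ?_, ?_⟩
      · intro z A hA
        simp only [hk] at hA
        split_ifs at hA with e
        · rw [hmem]
          exact ⟨z, e.le⟩
        · exact absurd hA (lt_irrefl _)
      · intro z A _ hA
        simp only [hk] at hA
        split_ifs at hA with e
        · rw [e]
          exact hzf z
        · exact absurd hA (lt_irrefl _)
    refine (iInf₂_le k hkv).trans (ENNReal.ofReal_le_ofReal ?_)
    have hMI : MI p k = ∑ z, p z * Real.logb 2 (1 / ∑ z' with g z' = g z, p z') := by
      unfold MI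
      refine Finset.sum_congr rfl fun z _ => ?_
      rw [Finset.sum_eq_single (f z)]
      · have : ∑ z', p z' * k z' (f z) = ∑ z' with g z' = g z, p z' := by
          rw [Finset.sum_filter]
          refine Finset.sum_congr rfl fun z' _ => ?_
          simp only [hk, hff, eq_comm (a := g z)]
          split_ifs <;> simp
        rw [this]
        simp [hk]
      · intro A _ hA
        simp [hk, hA]
      · simp
    rw [hMI]
    refine label_entropy p hp.2 hpos g (fun z => (hKF _ (hqblk z)).1) h hh ?_
    have := hfib fun B => Real.logb 2 (K B)
    rw [this] at hK
    exact hK.trans hmh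

/-- **Unconfusing lemma for coarse entropy.** If `supp(p) = Ω`,
`Y` is an ordinary information and `Y ⊆ X`, then there is an ordinary information `X̂`
with `Y ⊆ X̂ ⊆ X` and `H(X̂) ≤ H(X↘Y) + log₂(H(X↘Y) + 3.4) + 1`. -/
theorem stmt16 [Fintype Ω] (p : Ω → ℝ) (hp : IsPMF p) (hpos : ∀ ω : Ω, 0 < p ω)
    (X Y : Finset (Finset Ω)) (hX : IsHyp X) (hY : IsOI Y) (hYX : Y ⊆ X) :
    ∃ Xh : Finset (Finset Ω), IsOI Xh ∧ Y ⊆ Xh ∧ Xh ⊆ X ∧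
      Hent p Xh ≤ Hcoarse p X Y + elog2 (Hcoarse p X Y + ENNReal.ofReal 3.4) + 1 := by
  by_cases htop : Hcoarse p X Y = ⊤
  · refine ⟨Y, hY, subset_rfl, hYX, ?_⟩
    rw [htop]
    simp
  have hsub : Y ∪ singHyp Ω ⊆ X := by
    by_contra hno
    exact htop (by simp [Hcoarse, hno])
  obtain ⟨S, hSne, hSd, hS⟩ := hY
  -- the block containing a point
  set blk : Ω → Finset Ω := fun z => if hz : ∃ A ∈ S, z ∈ A then hz.choose else {z} with hb
  have hblkS : ∀ A ∈ S, ∀ z ∈ A, blk z = A := by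
    intro A hA z hzA
    have hz : ∃ A ∈ S, z ∈ A := ⟨A, hA, hzA⟩
    have e : blk z = hz.choose := by simp only [hb]; rw [dif_pos hz]
    obtain ⟨h1, h2⟩ := hz.choose_spec
    rw [e]
    by_contra hne
    exact Finset.disjoint_left.1 (hSd _ h1 _ hA hne) h2 hzA
  have hblk0 : ∀ z, (¬ ∃ A ∈ S, z ∈ A) → blk z = {z} := by
    intro z hz
    simp only [hb]
    rw [dif_neg hz]
  have hblk : ∀ z, z ∈ blk z := by
    intro z
    by_cases hz : ∃ A ∈ S, z ∈ A
    · obtain ⟨A, hA, hzA⟩ := hz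
      rw [hblkS A hA z hzA]
      exact hzA
    · rw [hblk0 z hz]
      simp
  have hblkY : ∀ z, blk z ∈ Y ∪ singHyp Ω := by
    intro z
    by_cases hz : ∃ A ∈ S, z ∈ A
    · obtain ⟨A, hA, hzA⟩ := hz
      rw [hblkS A hA z hzA]
      exact Finset.mem_union_left _ ((hS A).2 ⟨A, hA, subset_rfl⟩)
    · rw [hblk0 z hz]
      exact Finset.mem_union_right _ (by simp [singHyp])
  have hYb : ∀ C ∈ Y, C.Nonempty → ∃ z, C ⊆ blk z ∧ ∀ z' ∈ blk z, blk z' = blk z := by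
    intro C hC ⟨z, hz⟩
    obtain ⟨A, hA, hCA⟩ := (hS C).1 hC
    have e := hblkS A hA z (hCA hz)
    refine ⟨z, by rw [e]; exact hCA, fun z' hz' => ?_⟩
    rw [e] at hz' ⊢
    exact hblkS A hA z' hz'
  set q : Finset Ω → ℝ := fun B => ∑ z with blk z = B, p z with hqdef
  have hqv : ValidQ p (Y ∪ singHyp Ω) q := by
    refine ⟨fun B => Finset.sum_nonneg fun z _ => (hpos z).le, ?_, ?_, ?_⟩
    · intro B hB
      obtain ⟨z, hz, _⟩ := Finset.exists_ne_zero_of_sum_ne_zero hB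
      rw [← (Finset.mem_filter.1 hz).2]
      exact hblkY z
    · rw [← hp.2]
      exact Finset.sum_fiberwise Finset.univ blk p
    · intro T
      unfold pset
      rw [← Finset.sum_fiberwise_of_maps_to (fun z (_ : z ∈ T) => hblkY z)]
      refine Finset.sum_le_sum fun B _ => ?_
      split_ifs with hTB
      · exact Finset.sum_le_sum_of_subset_of_nonneg
          (Finset.filter_subset_filter _ (Finset.subset_univ T)) (fun z _ _ => (hpos z).le)
      · refine le_of_eq (Finset.sum_eq_zero fun z hz => ?_)
        obtain ⟨h1, h2⟩ := Finset.mem_filter.1 hz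
        exact absurd ⟨z, Finset.mem_inter.2 ⟨h1, h2 ▸ hblk z⟩⟩ hTB
  set h : ℝ := (Hcoarse p X Y).toReal with hh
  have hh0 : 0 ≤ h := ENNReal.toReal_nonneg
  have hHh : Hcoarse p X Y = ENNReal.ofReal h := (ENNReal.ofReal_toReal htop).symm
  -- room for a small slack
  obtain ⟨ε, hε, hslack⟩ : ∃ ε : ℝ, 0 < ε ∧
      h + ε + 1 + Real.logb 2 (h + ε + 2) ≤ h + Real.logb 2 (h + 3.4) + 1 := by
    have hc : ContinuousAt (fun ε : ℝ => h + ε + 1 + Real.logb 2 (h + ε + 2)) 0 := by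
      have h2 : h + 0 + 2 ≠ 0 := by positivity
      unfold Real.logb
      fun_prop (disch := assumption)
    have hlt : h + 0 + 1 + Real.logb 2 (h + 0 + 2) < h + Real.logb 2 (h + 3.4) + 1 := by
      have := Real.logb_lt_logb (b := 2) (by norm_num) (x := h + 0 + 2) (y := h + 3.4)
        (by positivity) (by norm_num)
      linarith
    have hev := hc.eventually (gt_mem_nhds hlt)
    have hev2 : ∀ᶠ ε in nhdsWithin (0 : ℝ) (Set.Ioi 0), h + ε + 1 + Real.logb 2 (h + ε + 2)
        < h + Real.logb 2 (h + 3.4) + 1 := hev.filter_mono nhdsWithin_le_nhds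
    obtain ⟨ε, h1, h2⟩ := (hev2.and self_mem_nhdsWithin).exists
    exact ⟨ε, h2, h1.le⟩
  have hinf : (⨅ (m : Finset Ω → Finset Ω → ℝ) (_ : ValidM X q m), ENNReal.ofReal (MI2 q m))
      < ENNReal.ofReal (h + ε) := by
    refine lt_of_le_of_lt ?_ ((ENNReal.ofReal_lt_ofReal_iff (by linarith)).2
      (show h < h + ε by linarith))
    rw [← hHh]
    unfold Hcoarse
    rw [if_pos hsub]
    exact le_iSup₂ (f := fun (q : Finset Ω → ℝ) (_ : ValidQ p (Y ∪ singHyp Ω) q) =>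
      ⨅ (m : Finset Ω → Finset Ω → ℝ) (_ : ValidM X q m), ENNReal.ofReal (MI2 q m)) q hqv
  obtain ⟨m, hm⟩ := iInf_lt_iff.1 hinf
  obtain ⟨hmv, hm⟩ := iInf_lt_iff.1 hm
  have hmh : MI2 q m ≤ h + ε :=
    ((ENNReal.ofReal_lt_ofReal_iff (by linarith)).1 hm).le
  obtain ⟨Xh, h1, h2, h3, h4⟩ := core_bound p hp hpos X Y hX blk hblk hYb q (fun _ => rfl) m hmv
    (h + ε) (by linarith) hmh
  refine ⟨Xh, h1, h2, h3, h4.trans ?_⟩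
  have hlog : 0 ≤ Real.logb 2 (h + 3.4) :=
    Real.logb_nonneg (by norm_num) (by norm_num; linarith)
  have e : Hcoarse p X Y + elog2 (Hcoarse p X Y + ENNReal.ofReal 3.4) + 1
      = ENNReal.ofReal (h + Real.logb 2 (h + 3.4) + 1) := by
    rw [hHh, ← ENNReal.ofReal_add hh0 (by norm_num), elog2, if_neg ENNReal.ofReal_ne_top,
      ENNReal.toReal_ofReal (by positivity), ← ENNReal.ofReal_add hh0 hlog,
      ← ENNReal.ofReal_one, ← ENNReal.ofReal_add (by positivity) (by norm_num)]
  rw [e]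
  exact ENNReal.ofReal_le_ofReal hslack

end
end

section
/- Let (Ω, p) and (Γ, q) be finite probability spaces, X a hyperconfusion over Ω, Y a hyperconfusion over Γ, and β : Ω → 2^Γ a hyper-expanding set-valued function from (Ω, p, X) to (Γ, q, Y). Then H(X) ≥ H(Y), where H(X) is computed with respect to p and H(Y) with respect to q. -/
open Finset
open scoped Classical ENNReal

noncomputable section

variable {Ω : Type*}

/-- Layer-cake comparison for finite distributions. -/
theorem aux_dom {Ω Γ : Type*} [Fintype Ω] [Fintype Γ] (p : Ω → ℝ) (q : Γ → ℝ)
    (hp : ∑ ω, p ω = 1) (hq : ∑ γ, q γ = 1) (u : Ω → ℝ) (v : Γ → ℝ)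
    (h : ∀ t : ℝ, ∑ ω, p ω * (if u ω ≤ t then 1 else 0) ≤ ∑ γ, q γ * (if v γ ≤ t then 1 else 0)) :
    ∑ γ, q γ * v γ ≤ ∑ ω, p ω * u ω := by
  obtain ⟨M, hM0, hMu, hMv⟩ : ∃ M : ℝ, 0 ≤ M ∧ (∀ ω, |u ω| ≤ M) ∧ (∀ γ, |v γ| ≤ M) := by
    have hs1 : 0 ≤ ∑ ω, |u ω| := Finset.sum_nonneg (fun _ _ => abs_nonneg _)
    have hs2 : 0 ≤ ∑ γ, |v γ| := Finset.sum_nonneg (fun _ _ => abs_nonneg _)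
    refine ⟨∑ ω, |u ω| + ∑ γ, |v γ|, by positivity, fun ω => ?_, fun γ => ?_⟩
    · have := Finset.single_le_sum (f := fun ω => |u ω|) (fun _ _ => abs_nonneg _) (mem_univ ω)
      linarith
    · have := Finset.single_le_sum (f := fun ω => |v ω|) (fun _ _ => abs_nonneg _) (mem_univ γ)
      linarith
  have hint : ∀ c : ℝ, IntervalIntegrable (fun t : ℝ => if c ≤ t then (1 : ℝ) else 0)
      MeasureTheory.volume (-M) M := by
    intro c
    apply Monotone.intervalIntegrable
    intro a b hab
    dsimp only
    split_ifs <;> first | linarith | norm_num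
  have hval : ∀ c : ℝ, |c| ≤ M → ∫ t in (-M)..M, (if c ≤ t then (1 : ℝ) else 0) = M - c := by
    intro c hc
    obtain ⟨h1, h2⟩ := abs_le.mp hc
    have hi1 : IntervalIntegrable (fun t : ℝ => if c ≤ t then (1 : ℝ) else 0)
      MeasureTheory.volume (-M) c := (hint c).mono_set (by
        rw [Set.uIcc_of_le h1, Set.uIcc_of_le (by linarith)]
        exact Set.Icc_subset_Icc le_rfl h2)
    have hi2 : IntervalIntegrable (fun t : ℝ => if c ≤ t then (1 : ℝ) else 0)
      MeasureTheory.volume c M := (hint c).mono_set (by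
        rw [Set.uIcc_of_le h2, Set.uIcc_of_le (by linarith)]
        exact Set.Icc_subset_Icc h1 le_rfl)
    rw [← intervalIntegral.integral_add_adjacent_intervals hi1 hi2]
    have e1 : ∫ t in (-M)..c, (if c ≤ t then (1 : ℝ) else 0) = ∫ t in (-M)..c, (0 : ℝ) := by
      apply intervalIntegral.integral_congr_ae
      have : ∀ᵐ t : ℝ, t ≠ c := by
        simp [MeasureTheory.ae_iff]
      filter_upwards [this] with t ht hmem
      rw [Set.uIoc_of_le h1] at hmem
      rw [if_neg]
      intro hh
      exact ht (le_antisymm hmem.2 hh)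
    have e2 : ∫ t in c..M, (if c ≤ t then (1 : ℝ) else 0) = ∫ t in c..M, (1 : ℝ) := by
      apply intervalIntegral.integral_congr
      intro t ht
      rw [Set.uIcc_of_le h2] at ht
      simp [ht.1]
    rw [e1, e2]
    simp
  have key : ∫ t in (-M)..M, ∑ ω, p ω * (if u ω ≤ t then (1 : ℝ) else 0) ≤
      ∫ t in (-M)..M, ∑ γ, q γ * (if v γ ≤ t then (1 : ℝ) else 0) := by
    apply intervalIntegral.integral_mono_on (by linarith)
    · have hh := IntervalIntegrable.sum univ (fun i _ => (hint (u i)).const_mul (p i))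
      rw [Finset.sum_fn] at hh
      exact hh
    · have hh := IntervalIntegrable.sum univ (fun i _ => (hint (v i)).const_mul (q i))
      rw [Finset.sum_fn] at hh
      exact hh
    · intro t _
      exact h t
  rw [intervalIntegral.integral_finsetSum (fun i _ => (hint (u i)).const_mul (p i)),
    intervalIntegral.integral_finsetSum (fun i _ => (hint (v i)).const_mul (q i))] at key
  simp only [intervalIntegral.integral_const_mul] at key
  simp only [hval _ (hMu _), hval _ (hMv _), mul_sub, Finset.sum_sub_distrib,
    ← Finset.sum_mul, hp, hq] at key
  linarith

/-- Pointwise lower bound on the information of a valid kernel. -/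
theorem aux_lower {Ω : Type*} [Fintype Ω] (z : Ω) (k r : Finset Ω → ℝ) (f : ℝ)
    (hk : ∀ A, 0 ≤ k A) (hk1 : ∑ A, k A = 1) (hr : ∀ A, 0 ≤ r A)
    (hkr : ∀ A, 0 < k A → 0 < r A ∧ z ∈ A) (hf : f = ∑ A, if z ∈ A then r A else 0)
    (hf0 : 0 < f) :
    - Real.log f ≤ ∑ A, k A * Real.log (k A / r A) := by
  have hterm : ∀ A, k A - (if z ∈ A then r A else 0) / f - k A * Real.log f ≤
      k A * Real.log (k A / r A) := by
    intro A
    rcases (hk A).eq_or_lt with h0 | h0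
    · rw [← h0]
      have : 0 ≤ (if z ∈ A then r A else 0) / f := by
        apply div_nonneg _ hf0.le
        split_ifs
        · exact hr A
        · exact le_rfl
      simp only [zero_mul]
      linarith
    · obtain ⟨hrA, hz⟩ := hkr A h0
      rw [if_pos hz]
      have h1 := Real.log_le_sub_one_of_pos (x := r A / (k A * f)) (by positivity)
      rw [Real.log_div hrA.ne' (by positivity), Real.log_mul h0.ne' hf0.ne'] at h1
      rw [Real.log_div h0.ne' hrA.ne']
      have h2 := mul_le_mul_of_nonneg_left h1 h0.le
      have h3 : k A * (r A / (k A * f) - 1) = r A / f - k A := by field_simp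
      rw [h3] at h2
      linarith
  have := Finset.sum_le_sum (fun A (_ : A ∈ univ) => hterm A)
  simp only [Finset.sum_sub_distrib, ← Finset.sum_mul, ← Finset.sum_div, hk1, ← hf] at this
  rw [div_self hf0.ne'] at this
  linarith

/-- Upper bound on the information of the kernel induced by a distribution `s`. -/
theorem aux_upper {Γ : Type*} [Fintype Γ] (q : Γ → ℝ) (hq : IsPMF q) (s : Finset Γ → ℝ)
    (hs : ∀ B, 0 ≤ s B) (hs1 : ∑ B, s B = 1) (g : Γ → ℝ)
    (hg0 : ∀ γ, 0 < q γ → 0 < g γ) (k : Γ → Finset Γ → ℝ)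
    (hk0 : ∀ γ B, 0 ≤ k γ B) (hk1 : ∀ γ, ∑ B, k γ B = 1)
    (hk : ∀ γ B, 0 < q γ → 0 < k γ B → k γ B = s B / g γ) :
    ∑ γ, ∑ B, q γ * k γ B * Real.log (k γ B / ∑ γ', q γ' * k γ' B) ≤
      ∑ γ, q γ * (- Real.log (g γ)) := by
  set m : Finset Γ → ℝ := fun B => ∑ γ', q γ' * k γ' B with hm
  have hterm : ∀ γ B, q γ * k γ B * Real.log (k γ B / m B) ≤
      q γ * (- Real.log (g γ)) * k γ B + q γ * k γ B * (s B / m B) - q γ * k γ B := by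
    intro γ B
    rcases (hq.1 γ).eq_or_lt with h0 | h0
    · simp [← h0]
    rcases (hk0 γ B).eq_or_lt with h1 | h1
    · simp [← h1]
    have hmB : 0 < m B := by
      have h2 := Finset.single_le_sum (f := fun γ => q γ * k γ B)
        (fun i _ => mul_nonneg (hq.1 i) (hk0 i B)) (mem_univ γ)
      have : 0 < q γ * k γ B := mul_pos h0 h1
      exact this.trans_le h2
    have hgp := hg0 γ h0
    have he := hk γ B h0 h1
    have hsB : 0 < s B := by
      rcases (hs B).eq_or_lt with h2 | h2
      · rw [he, ← h2, zero_div] at h1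
        exact absurd h1 (lt_irrefl _)
      · exact h2
    have h3 : Real.log (k γ B / m B) = - Real.log (g γ) + Real.log (s B / m B) := by
      rw [he, Real.log_div (by positivity) hmB.ne', Real.log_div hsB.ne' hgp.ne',
        Real.log_div hsB.ne' hmB.ne']
      ring
    have h4 := Real.log_le_sub_one_of_pos (x := s B / m B) (by positivity)
    have h5 := mul_le_mul_of_nonneg_left h4 (mul_pos h0 h1).le
    rw [h3]
    linarith
  have hsum := Finset.sum_le_sum (fun γ (_ : γ ∈ univ) =>
    Finset.sum_le_sum (fun B (_ : B ∈ univ) => hterm γ B))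
  simp only [Finset.sum_sub_distrib, Finset.sum_add_distrib, ← Finset.mul_sum, hk1, mul_one,
    hq.2] at hsum
  have h6 : ∑ γ, ∑ B, q γ * k γ B * (s B / m B) ≤ 1 := by
    rw [Finset.sum_comm, ← hs1]
    apply Finset.sum_le_sum
    intro B _
    rw [← Finset.sum_mul]
    change m B * (s B / m B) ≤ s B
    by_cases h : m B = 0
    · simp [h, hs B]
    · rw [mul_div_cancel₀ _ h]
  linarith

theorem aux_MI {Ω : Type*} [Fintype Ω] (p : Ω → ℝ) (k : Ω → Finset Ω → ℝ) :
    MI p k = (∑ z, ∑ A, p z * k z A * Real.log (k z A / ∑ z', p z' * k z' A)) / Real.log 2 := by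
  unfold MI
  simp only [Real.logb, Finset.sum_div, mul_div_assoc]

theorem aux_main {Ω Γ : Type*} [Fintype Ω] [Fintype Γ]
    (p : Ω → ℝ) (q : Γ → ℝ) (hp : IsPMF p) (hq : IsPMF q)
    (X : Finset (Finset Ω)) (Y : Finset (Finset Γ)) (hY : IsHyp Y)
    (β : Ω → Finset Γ)
    (hconf : ∀ A ∈ X, A.biUnion β ∈ Y)
    (hexp : ∀ A : Finset Ω, pset p A ≤ pset q (A.biUnion β))
    (k : Ω → Finset Ω → ℝ) (hk : ValidK p X k) :
    ∃ k' : Γ → Finset Γ → ℝ, ValidK q Y k' ∧ MI q k' ≤ MI p k := by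
  obtain ⟨hk0, hk1, hkX, hkz⟩ := hk
  set r : Finset Ω → ℝ := fun A => ∑ z', p z' * k z' A with hr
  have hr0 : ∀ A, 0 ≤ r A := fun A => Finset.sum_nonneg fun z _ => mul_nonneg (hp.1 z) (hk0 z A)
  have hr1 : ∑ A, r A = 1 := by
    simp only [hr]
    rw [Finset.sum_comm]
    simp only [← Finset.mul_sum, hk1, mul_one, hp.2]
  have hrpos : ∀ z A, 0 < p z → 0 < k z A → 0 < r A := by
    intro z A h0 h1
    have h2 := Finset.single_le_sum (f := fun z => p z * k z A)
        (fun i _ => mul_nonneg (hp.1 i) (hk0 i A)) (mem_univ z)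
    exact (mul_pos h0 h1).trans_le h2
  have hrX : ∀ A, 0 < r A → A ∈ X := by
    intro A h
    obtain ⟨z, _, hz⟩ := Finset.exists_ne_zero_of_sum_ne_zero h.ne'
    exact hkX z A ((hk0 z A).lt_of_ne' (right_ne_zero_of_mul hz))
  set f : Ω → ℝ := fun z => ∑ A, if z ∈ A then r A else 0 with hf
  have hf0 : ∀ z, 0 < p z → 0 < f z := by
    intro z hz
    obtain ⟨A, _, hA⟩ := Finset.exists_ne_zero_of_sum_ne_zero
      (show ∑ A, k z A ≠ 0 by rw [hk1]; norm_num)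
    have hA' : 0 < k z A := (hk0 z A).lt_of_ne' hA
    have h2 := Finset.single_le_sum (f := fun A => if z ∈ A then r A else 0)
      (fun i _ => by split_ifs; exacts [hr0 i, le_rfl]) (mem_univ A)
    simp only [if_pos (hkz z A hz hA')] at h2
    exact (hrpos z A hz hA').trans_le h2
  set s : Finset Γ → ℝ := fun B => ∑ A, if A.biUnion β = B then r A else 0 with hs
  have hs0 : ∀ B, 0 ≤ s B := fun B => Finset.sum_nonneg fun A _ => by
    split_ifs
    exacts [hr0 A, le_rfl]
  have hs1 : ∑ B, s B = 1 := by
    simp only [hs]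
    rw [Finset.sum_comm]
    simp [hr1]
  have hsY : ∀ B, 0 < s B → B ∈ Y := by
    intro B h
    obtain ⟨A, _, hA⟩ := Finset.exists_ne_zero_of_sum_ne_zero h.ne'
    split_ifs at hA with h1
    · rw [← h1]
      exact hconf A (hrX A ((hr0 A).lt_of_ne' hA))
    · exact absurd rfl hA
  set g : Γ → ℝ := fun γ => ∑ B, if γ ∈ B then s B else 0 with hg
  have hg' : ∀ γ, g γ = ∑ A, if γ ∈ A.biUnion β then r A else 0 := by
    intro γ
    have : ∀ B, (if γ ∈ B then s B else 0) =
        ∑ A : Finset Ω, if A.biUnion β = B then (if γ ∈ B then r A else 0) else 0 := by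
      intro B
      by_cases h : γ ∈ B <;> simp [h, hs]
    simp only [hg, this]
    rw [Finset.sum_comm]
    simp only [Finset.sum_ite_eq, mem_univ, if_true]
  have hfg : ∀ ω γ, γ ∈ β ω → f ω ≤ g γ := by
    intro ω γ h
    rw [hg']
    apply Finset.sum_le_sum
    intro A _
    by_cases h1 : ω ∈ A
    · rw [if_pos h1, if_pos (mem_biUnion.mpr ⟨ω, h1, h⟩)]
    · rw [if_neg h1]
      split_ifs
      exacts [hr0 A, le_rfl]
  have hcover : ∀ γ, 0 < q γ → ∃ ω, 0 < p ω ∧ γ ∈ β ω := by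
    intro γ hγ
    by_contra hcon
    push Not at hcon
    have h1 := hexp (univ.filter fun ω => 0 < p ω)
    have h2 : pset p (univ.filter fun ω => 0 < p ω) = 1 := by
      unfold pset
      rw [← hp.2]
      apply Finset.sum_subset (filter_subset _ _)
      intro ω _ hω
      simp only [mem_filter, mem_univ, true_and, not_lt] at hω
      exact le_antisymm hω (hp.1 ω)
    have h3 : γ ∉ (univ.filter fun ω => 0 < p ω).biUnion β := by
      intro h
      obtain ⟨ω, hω, hω'⟩ := mem_biUnion.mp h
      exact hcon ω (mem_filter.mp hω).2 hω'
    have h4 : q γ + pset q ((univ.filter fun ω => 0 < p ω).biUnion β) ≤ 1 := by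
      unfold pset
      rw [← Finset.sum_insert h3, ← hq.2]
      exact Finset.sum_le_sum_of_subset_of_nonneg (subset_univ _) (fun i _ _ => hq.1 i)
    linarith
  have hg0 : ∀ γ, 0 < q γ → 0 < g γ := by
    intro γ hγ
    obtain ⟨ω, h1, h2⟩ := hcover γ hγ
    exact (hf0 ω h1).trans_le (hfg ω γ h2)
  have hemp : (∅ : Finset Γ) ∈ Y := by
    obtain ⟨⟨B, hB⟩, h2⟩ := hY
    exact h2 B hB ∅ (empty_subset _)
  let k' : Γ → Finset Γ → ℝ := fun γ B =>
    if 0 < q γ then (if γ ∈ B then s B else 0) / g γ else if B = ∅ then 1 else 0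
  have hk'0 : ∀ γ B, 0 ≤ k' γ B := by
    intro γ B
    simp only [k']
    split_ifs with h1 h2 h3
    · exact div_nonneg (hs0 B) (hg0 γ h1).le
    · simp
    · norm_num
    · exact le_rfl
  have hk'1 : ∀ γ, ∑ B, k' γ B = 1 := by
    intro γ
    by_cases h : 0 < q γ
    · simp only [k', if_pos h]
      rw [← Finset.sum_div]
      exact div_self (hg0 γ h).ne'
    · simp [k', h]
  have hk'2 : ∀ γ B, 0 < q γ → 0 < k' γ B → γ ∈ B ∧ k' γ B = s B / g γ := by
    intro γ B h1 h2
    simp only [k', if_pos h1] at h2 ⊢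
    by_cases h : γ ∈ B
    · simp [h]
    · simp [h] at h2
  refine ⟨k', ⟨hk'0, hk'1, ?_, fun γ B h1 h2 => (hk'2 γ B h1 h2).1⟩, ?_⟩
  · intro γ B h
    by_cases h1 : 0 < q γ
    · have h2 := (hk'2 γ B h1 h).2
      apply hsY
      rw [h2] at h
      exact (div_pos_iff_of_pos_right (hg0 γ h1)).mp h
    · by_cases h2 : B = ∅
      · rw [h2]
        exact hemp
      · simp [k', h1, h2] at h
  rw [aux_MI, aux_MI]
  apply div_le_div_of_nonneg_right _ (Real.log_nonneg (by norm_num))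
  have hup := aux_upper q hq s hs0 hs1 g hg0 k' hk'0 hk'1 (fun γ B h1 h2 => (hk'2 γ B h1 h2).2)
  refine hup.trans ?_
  have hlow : ∑ ω, p ω * (- Real.log (f ω)) ≤
      ∑ z, ∑ A, p z * k z A * Real.log (k z A / r A) := by
    apply Finset.sum_le_sum
    intro z _
    rcases (hp.1 z).eq_or_lt with h0 | h0
    · simp [← h0]
    have h1 := aux_lower z (k z) r (f z) (hk0 z) (hk1 z) hr0
      (fun A hA => ⟨hrpos z A h0 hA, hkz z A h0 hA⟩) rfl (hf0 z h0)
    simp only [mul_assoc]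
    rw [← Finset.mul_sum]
    exact mul_le_mul_of_nonneg_left h1 h0.le
  refine le_trans ?_ hlow
  apply aux_dom p q hp.2 hq.2
  intro t
  have e1 : ∑ ω, p ω * (if - Real.log (f ω) ≤ t then (1 : ℝ) else 0) =
      pset p (univ.filter fun ω => 0 < p ω ∧ - Real.log (f ω) ≤ t) := by
    unfold pset
    rw [Finset.sum_filter]
    apply Finset.sum_congr rfl
    intro ω _
    rcases (hp.1 ω).eq_or_lt with h0 | h0
    · simp [← h0]
    · simp [h0]
  rw [e1]
  refine (hexp _).trans ?_
  have e2 : ∑ γ, q γ * (if - Real.log (g γ) ≤ t then (1 : ℝ) else 0) =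
      pset q (univ.filter fun γ => - Real.log (g γ) ≤ t) := by
    unfold pset
    rw [Finset.sum_filter]
    apply Finset.sum_congr rfl
    intro γ _
    simp
  rw [e2]
  apply Finset.sum_le_sum_of_subset_of_nonneg
  · intro γ h
    obtain ⟨ω, hω, h1⟩ := mem_biUnion.mp h
    obtain ⟨-, h2, h3⟩ := mem_filter.mp hω
    refine mem_filter.mpr ⟨mem_univ _, ?_⟩
    have := Real.log_le_log (hf0 ω h2) (hfg ω γ h1)
    linarith
  · intro i _ _
    exact hq.1 i

/-- A hyper-expanding set-valued function from `(Ω, p, X)` to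
`(Γ, q, Y)` does not increase entropy: `H(X) ≥ H(Y)`. -/
theorem stmt17 {Ω Γ : Type*} [Fintype Ω] [Fintype Γ]
    (p : Ω → ℝ) (q : Γ → ℝ) (hp : IsPMF p) (hq : IsPMF q)
    (X : Finset (Finset Ω)) (Y : Finset (Finset Γ)) (hX : IsHyp X) (hY : IsHyp Y)
    (β : Ω → Finset Γ)
    (hconf : ∀ A ∈ X, A.biUnion β ∈ Y)
    (hexp : ∀ A : Finset Ω, pset p A ≤ pset q (A.biUnion β)) :
    Hent q Y ≤ Hent p X := by
  refine le_iInf₂ fun k hk => ?_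
  obtain ⟨k', hk', hle⟩ := aux_main p q hp hq X Y hY β hconf hexp k hk
  exact (iInf₂_le k' hk').trans (ENNReal.ofReal_le_ofReal hle)

end
end

section
/- Let H be a Heyting algebra and H_¬ := {x ∈ H : x = ¬¬x} its set of regular elements. Let U be a set and ψ : H_¬ → 2^U a map such that for all x, y ∈ H_¬: ψ(x ∧ y) = ψ(x) ∩ ψ(y), ψ(¬x) = U ∖ ψ(x), ψ(⊥) = ∅, and x ≤ y ↔ ψ(x) ⊆ ψ(y). Define ζ : H → 2^{2^U} by ζ(x) := ∪_{z ∈ H_¬, z ≤ x} 2^{ψ(z)}. Then for all x, y ∈ H: (i) ζ(x ∧ y) = ζ(x) ∩ ζ(y), ζ(⊥) = {∅}, and ζ(⊤) = 2^U; (ii) x ≤ y implies ζ(x) ⊆ ζ(y); (iii) ζ(x → y) ⊆ (ζ(x) → ζ(y)) and ζ(¬x) ⊆ ¬ζ(x), where for downward-closed families A, B ⊆ 2^U the implication is A→B := {S ⊆ U : A ∩ 2^S ⊆ B} and ¬A := A→{∅}; (iv) ζ(x ∨ y) ⊇ ζ(x) ∪ ζ(y). -/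
/-- The hyperconfusion pseudo-embedding `ζ(x) = ∪_{z regular, z ≤ x} 2^{ψ(z)}`,
as a family of subsets of `U`. -/
def zeta {H : Type*} [HeytingAlgebra H] {U : Type*} (ψ : H → Set U) (x : H) :
    Set (Set U) :=
  {S | ∃ z : H, z = zᶜᶜ ∧ z ≤ x ∧ S ⊆ ψ z}

/-- The Heyting implication `A → B := {S ⊆ U : A ∩ 2^S ⊆ B}` of families of subsets. -/
def hImpSet {U : Type*} (A B : Set (Set U)) : Set (Set U) :=
  {S | ∀ T ∈ A, T ⊆ S → T ∈ B}

/-- For a Heyting algebra `H` and a map `ψ` on the regular elements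
`H_¬` behaving like a Stone embedding (preserving/reflecting order, meets, complements
and `⊥`), the pseudo-embedding `ζ` preserves meets, `⊥`, `⊤` and order, sub-commutes
with implication and negation, and super-commutes with joins. -/
theorem stmt19 {H : Type*} [HeytingAlgebra H] {U : Type*} (ψ : H → Set U)
    (hmeet : ∀ x y : H, x = xᶜᶜ → y = yᶜᶜ → ψ (x ⊓ y) = ψ x ∩ ψ y)
    (hcompl : ∀ x : H, x = xᶜᶜ → ψ xᶜ = (ψ x)ᶜ)
    (hbot : ψ ⊥ = ∅)
    (horder : ∀ x y : H, x = xᶜᶜ → y = yᶜᶜ → (x ≤ y ↔ ψ x ⊆ ψ y)) :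
    ∀ x y : H,
      zeta ψ (x ⊓ y) = zeta ψ x ∩ zeta ψ y ∧
      zeta ψ (⊥ : H) = {(∅ : Set U)} ∧
      zeta ψ (⊤ : H) = Set.univ ∧
      (x ≤ y → zeta ψ x ⊆ zeta ψ y) ∧
      zeta ψ (x ⇨ y) ⊆ hImpSet (zeta ψ x) (zeta ψ y) ∧
      zeta ψ xᶜ ⊆ hImpSet (zeta ψ x) {(∅ : Set U)} ∧
      zeta ψ x ∪ zeta ψ y ⊆ zeta ψ (x ⊔ y) := by
  have hinf : ∀ a b : H, a = aᶜᶜ → b = bᶜᶜ → a ⊓ b = (a ⊓ b)ᶜᶜ := by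
    intro a b ha hb
    rw [compl_compl_inf_distrib, ← ha, ← hb]
  have hmono : ∀ a b : H, a ≤ b → zeta ψ a ⊆ zeta ψ b := by
    rintro a b hab S ⟨z, hz, hza, hS⟩
    exact ⟨z, hz, hza.trans hab, hS⟩
  have hmt : ∀ a b : H, zeta ψ (a ⊓ b) = zeta ψ a ∩ zeta ψ b := by
    intro a b
    apply Set.Subset.antisymm
    · exact fun S hS => ⟨hmono _ _ inf_le_left hS, hmono _ _ inf_le_right hS⟩
    · rintro S ⟨⟨z, hz, hza, hS⟩, ⟨w, hw, hwb, hS'⟩⟩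
      refine ⟨z ⊓ w, hinf z w hz hw, inf_le_inf hza hwb, ?_⟩
      rw [hmeet z w hz hw]
      exact Set.subset_inter hS hS'
  have hdown : ∀ (a : H) (S T : Set U), S ∈ zeta ψ a → T ⊆ S → T ∈ zeta ψ a := by
    rintro a S T ⟨z, hz, hza, hS⟩ hT
    exact ⟨z, hz, hza, hT.trans hS⟩
  have hb : zeta ψ (⊥ : H) = {(∅ : Set U)} := by
    ext S
    constructor
    · rintro ⟨z, hz, hzb, hS⟩
      rw [le_bot_iff.mp hzb, hbot] at hS
      exact Set.subset_empty_iff.mp hS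
    · intro hS
      rw [Set.mem_singleton_iff] at hS
      subst hS
      exact ⟨⊥, by simp, le_rfl, Set.empty_subset _⟩
  have himp : ∀ a b : H, zeta ψ (a ⇨ b) ⊆ hImpSet (zeta ψ a) (zeta ψ b) := by
    intro a b S hS T hT hTS
    have h : T ∈ zeta ψ ((a ⇨ b) ⊓ a) := by
      rw [hmt]
      exact ⟨hdown _ _ _ hS hTS, hT⟩
    exact hmono _ _ himp_inf_le h
  intro x y
  refine ⟨hmt x y, hb, ?_, hmono x y, himp x y, ?_, ?_⟩
  · ext S
    refine ⟨fun _ => Set.mem_univ _, fun _ => ⟨⊤, by simp, le_rfl, ?_⟩⟩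
    have h := hcompl (⊥ : H) (by simp)
    rw [compl_bot, hbot, Set.compl_empty] at h
    rw [h]
    exact Set.subset_univ _
  · rw [← hb, ← himp_bot]
    exact himp x ⊥
  · exact Set.union_subset (hmono _ _ le_sup_left) (hmono _ _ le_sup_right)
end
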